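/- For positive integers N, m and 1 ≤ l ≤ N, the number of rhombus tilings of a hexagon with sides N+1, 2m−1, N+1, N+1, 2m−1, N+1 containing the l-th rhombus on the symmetry axis that cuts through the sides of length 2m−1 equals [ m·C(m+N,m)·C(m+N−1,m) / C(2m+2N−1, 2m) ] · [ ∑_{e=0}^{l−1} (−1)^e C(N,e) (N−2e)(1/2)_e / ((m+e)(m+N−e)(1/2−N)_e) ] · ∏_{i=1}^{N+1} ∏_{j=1}^{N+1} ∏_{k=1}^{2m−1} (i+j+k−1)/(i+j+k−2). -/

import Mathlib

/-- A unit triangle of the triangular lattice: `(i, j, d)` where `d = false`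
denotes the upward triangle with corners `(i,j), (i+1,j), (i,j+1)` (in lattice
coordinates) and `d = true` the downward triangle with corners
`(i+1,j), (i,j+1), (i+1,j+1)`. -/
abbrev Triangle := ℤ × ℤ × Bool

/-- The triangles making up the hexagon with side lengths `a,b,c,a,b,c`
(bottom side `a`, then sides `b` and `c` counterclockwise), all angles 120°. -/
def inHexagon (a b c : ℕ) (t : Triangle) : Prop :=
  -(c : ℤ) ≤ t.1 ∧ t.1 ≤ (a : ℤ) - 1 ∧ 0 ≤ t.2.1 ∧ t.2.1 ≤ (b : ℤ) + c - 1 ∧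
  (if t.2.2 then -1 ≤ t.1 + t.2.1 ∧ t.1 + t.2.1 ≤ (a : ℤ) + b - 2
   else 0 ≤ t.1 + t.2.1 ∧ t.1 + t.2.1 ≤ (a : ℤ) + b - 1)

/-- A rhombus (lozenge) tile: `(i, j, d)` is the unit rhombus consisting of the
upward triangle `(i,j)` together with an adjacent downward triangle: the one at
`(i,j)` if `d = 0`, at `(i-1,j)` if `d = 1`, and at `(i,j-1)` if `d = 2`
(the three orientations of a unit rhombus with angles 60° and 120°). -/
abbrev Tile := ℤ × ℤ × Fin 3

/-- The two unit triangles covered by a rhombus tile. -/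
def covers (t : Tile) (x : Triangle) : Prop :=
  x = (t.1, t.2.1, false) ∨
  x = (if t.2.2 = 0 then (t.1, t.2.1, true)
       else if t.2.2 = 1 then (t.1 - 1, t.2.1, true)
       else (t.1, t.2.1 - 1, true))

/-- `T` is a rhombus tiling of the hexagon with sides `a,b,c,a,b,c`: every tile
stays inside the hexagon and every unit triangle of the hexagon is covered by
exactly one tile. -/
def IsTiling (a b c : ℕ) (T : Set Tile) : Prop :=
  (∀ t ∈ T, ∀ x, covers t x → inHexagon a b c x) ∧
  (∀ x, inHexagon a b c x → ∃! t, t ∈ T ∧ covers t x)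

/-- The shifted factorial (Pochhammer symbol) `(x)_k = x(x+1)⋯(x+k-1)`. -/
def poch (x : ℚ) (k : ℕ) : ℚ := ∏ t ∈ Finset.range k, (x + t)

section Algebra

lemma poch_zero (x : ℚ) : poch x 0 = 1 := by simp [poch]

lemma poch_succ (x : ℚ) (k : ℕ) : poch x (k + 1) = poch x k * (x + k) := by
  simp [poch, Finset.prod_range_succ]

lemma poch_succ_left (x : ℚ) (k : ℕ) : poch x (k + 1) = x * poch (x + 1) k := by
  simp only [poch, Finset.prod_range_succ', Nat.cast_zero, add_zero]
  rw [mul_comm]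
  congr 1
  refine Finset.prod_congr rfl fun t _ => ?_
  push_cast; ring

lemma poch_pos {x : ℚ} (hx : 0 < x) (k : ℕ) : 0 < poch x k :=
  Finset.prod_pos fun _ _ => by positivity

lemma poch_add (x : ℚ) (j k : ℕ) : poch x (j + k) = poch x j * poch (x + j) k := by
  induction k with
  | zero => simp [poch_zero]
  | succ k ih => rw [← add_assoc, poch_succ, ih, poch_succ]; push_cast; ring

/-- Reflection of the shifted factorial. -/
lemma poch_neg (x : ℚ) (k : ℕ) : poch (1 - x - k) k = (-1) ^ k * poch x k := by
  induction k generalizing x with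
  | zero => simp [poch_zero]
  | succ k ih =>
    rw [poch_succ, poch_succ_left x, pow_succ]
    have := ih (x + 1)
    rw [show 1 - (x + 1) - (k : ℚ) = 1 - x - (k + 1 : ℕ) by push_cast; ring] at this
    rw [this]; push_cast; ring

lemma poch_one (k : ℕ) : poch 1 k = (k.factorial : ℚ) := by
  induction k with
  | zero => simp [poch_zero]
  | succ k ih => rw [poch_succ, ih, Nat.factorial_succ]; push_cast; ring

lemma factorial_mul_poch (a k : ℕ) :
    (a.factorial : ℚ) * poch (a + 1) k = ((a + k).factorial : ℚ) := by
  rw [← poch_one, ← poch_one, poch_add, add_comm (1 : ℚ)]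

lemma factorial_two_mul (k : ℕ) :
    ((2 * k).factorial : ℚ) = 4 ^ k * poch (1 / 2) k * (k.factorial : ℚ) := by
  induction k with
  | zero => simp [poch_zero]
  | succ k ih =>
    rw [show 2 * (k + 1) = 2 * k + 1 + 1 by ring, Nat.factorial_succ, Nat.factorial_succ,
      Nat.factorial_succ, poch_succ]
    push_cast
    rw [ih]
    ring

/-- The Pfaff–Saalschütz summation in polynomial form. -/
lemma saalschutz (k : ℕ) (a b e : ℚ) :
    ∑ i ∈ Finset.range (k + 1), (k.choose i : ℚ) * poch a i * poch b i * poch e (k - i) *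
      poch (a + b + e + i) (k - i) = poch (a + e) k * poch (b + e) k := by
  induction k with
  | zero => simp [poch_zero]
  | succ k ih =>
    rw [poch_succ, poch_succ]
    set X : ℕ → ℚ := fun i => poch a i * poch b i * poch e (k + 1 - i) *
      poch (a + b + e + i) (k + 1 - i) with hX
    set F : ℕ → ℚ := fun i => (k.choose i : ℚ) * poch a i * poch b i * poch e (k - i) *
      poch (a + b + e + i) (k - i) with hF
    have pascal : ∑ i ∈ Finset.range (k + 1 + 1), ((k + 1).choose i : ℚ) * X i =
        ∑ i ∈ Finset.range (k + 1), ((k.choose i : ℚ) * X i + (k.choose i : ℚ) * X (i + 1)) := by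
      rw [Finset.sum_range_succ', Finset.sum_add_distrib,
        ← Finset.sum_range_succ_sub_top (fun i => (k.choose i : ℚ) * X i) (n := k + 1),
        Finset.sum_range_succ' (fun i => (k.choose i : ℚ) * X i) (k + 1)]
      simp only [Nat.choose_succ_succ, Nat.choose_succ_self, Nat.choose_zero_right]
      push_cast
      simp only [add_mul, Finset.sum_add_distrib]
      ring
    have telescope : ∀ i ∈ Finset.range (k + 1),
        (k.choose i : ℚ) * X i + (k.choose i : ℚ) * X (i + 1) -
          (a + e + k) * (b + e + k) * F i =
        ((i + 1 : ℕ) : ℚ) * (e + k - (i + 1 : ℕ)) * F (i + 1) - (i : ℚ) * (e + k - i) * F i := by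
      intro i hi
      obtain ⟨d, rfl⟩ := Nat.exists_eq_add_of_le (Finset.mem_range_succ_iff.1 hi)
      have hc : ((i + 1 : ℕ) : ℚ) * ((i + d).choose (i + 1) : ℚ) =
          ((i + d).choose i : ℚ) * d := by
        have := Nat.choose_succ_right_eq (i + d) i
        rw [Nat.add_sub_cancel_left] at this
        rw [mul_comm]; exact_mod_cast this
      simp only [hX, hF, Nat.add_sub_cancel_left, Nat.add_sub_add_right,
        show i + d + 1 - i = d + 1 by omega]
      cases d with
      | zero =>
        simp [poch_zero, poch_succ]; ring
      | succ d =>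
        simp only [show i + (d + 1) - (i + 1) = d by omega]
        rw [poch_succ_left (a + b + e + i) (d + 1), poch_succ_left (a + b + e + i) d,
          show a + b + e + ((i + 1 : ℕ) : ℚ) = a + b + e + i + 1 by push_cast; ring,
          poch_succ _ d, poch_succ e (d + 1), poch_succ e d, poch_succ a, poch_succ b]
        push_cast at hc ⊢
        linear_combination (-(poch a i * (a + i) * (poch b i * (b + i)) * poch e d *
          poch (a + b + e + i + 1) d * (e + d))) * hc
    have key := Finset.sum_congr rfl telescope
    rw [Finset.sum_sub_distrib, ← Finset.mul_sum,
      Finset.sum_range_sub (fun i : ℕ => (i : ℚ) * (e + k - i) * F i), ih, ← pascal] at key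
    have h0 : F (k + 1) = 0 := by simp [hF]
    rw [h0] at key
    simp only [hX, ← mul_assoc] at key
    simp only [Nat.cast_zero, mul_zero, zero_mul, sub_zero] at key
    linear_combination key

end Algebra

section Jacobi

lemma poch_eq_zero {x : ℚ} {k j : ℕ} (hj : j < k) (h : x + j = 0) : poch x k = 0 :=
  Finset.prod_eq_zero (Finset.mem_range.2 hj) h

lemma factorial_two_mul_add (n i : ℕ) :
    ((2 * (n + i)).factorial : ℚ) =
      ((2 * n).factorial : ℚ) * (4 ^ i * poch (n + 1 / 2) i * poch (n + 1) i) := by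
  rw [factorial_two_mul, factorial_two_mul, poch_add, ← factorial_mul_poch, pow_add,
    add_comm (1 / 2 : ℚ)]
  ring

lemma cast_centralBinom_choose (k : ℕ) :
    ((2 * k).choose k : ℚ) = 4 ^ k * poch (1 / 2) k / (k.factorial : ℚ) := by
  have hk : (k.factorial : ℚ) ≠ 0 := by positivity
  rw [Nat.cast_choose ℚ (by omega : k ≤ 2 * k), factorial_two_mul,
    show 2 * k - k = k by omega]
  field_simp

lemma choose_central_add (d i : ℕ) :
    ((2 * (d + i)).choose (d + i) : ℚ) =
      ((2 * d).choose d : ℚ) * (4 ^ i * poch (d + 1 / 2) i / poch (d + 1) i) := by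
  have h1 : poch ((d : ℚ) + 1) i ≠ 0 := (poch_pos (by positivity) i).ne'
  have hk : (d.factorial : ℚ) ≠ 0 := by positivity
  rw [cast_centralBinom_choose, cast_centralBinom_choose, poch_add, ← factorial_mul_poch, pow_add,
    add_comm (1 / 2 : ℚ)]
  field_simp

/-- The coefficients of the polynomials orthogonal for the weight
`x ^ (n - 1 / 2) * (4 - x) ^ (- 1 / 2)` on `[0, 4]`. -/
def jacobiCoeff (n k i : ℕ) : ℚ :=
  (-1) ^ i * (k.choose i : ℚ) * poch (k + n) i / (4 ^ i * poch (n + 1 / 2) i)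

/-- The coefficients of `(2 + z + 1 / z) ^ n * p (2 + z + 1 / z)`, where `p` is the polynomial
with coefficients `jacobiCoeff n k`. -/
def jacobiLaurent (n k q : ℕ) : ℚ :=
  (-1) ^ k * poch (q + 1 - k) k * poch q k * ((2 * n).factorial : ℚ) /
    ((2 * (n + k)).factorial : ℚ) * ((2 * (n + k)).choose (n + k + q) : ℚ)

lemma choose_mul_factorial_mul_factorial {n k i q : ℕ} (hi : i ≤ k) (hq : q ≤ n + k) :
    ((2 * (n + i)).choose (n + i + q) : ℚ) *
        (((n + k + q).factorial : ℚ) * ((n + k - q).factorial : ℚ)) =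
      ((2 * (n + i)).factorial : ℚ) * (poch (n + i + q + 1) (k - i) *
        poch (n + i + 1 - q) (k - i)) := by
  obtain ⟨j, rfl⟩ := Nat.exists_eq_add_of_le hi
  rw [Nat.add_sub_cancel_left]
  rcases le_or_gt q (n + i) with h | h
  · obtain ⟨r, hr⟩ := Nat.exists_eq_add_of_le h
    have e1 := factorial_mul_poch (n + i + q) j
    have e2 := factorial_mul_poch r j
    have hr' : (n : ℚ) + i = q + r := by exact_mod_cast hr
    rw [show n + (i + j) + q = n + i + q + j by ring, show n + (i + j) - q = r + j by omega,
      ← e1, ← e2, Nat.cast_choose ℚ (by omega : n + i + q ≤ 2 * (n + i)),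
      show 2 * (n + i) - (n + i + q) = r by omega,
      show (n : ℚ) + i + 1 - q = r + 1 by rw [hr']; ring]
    have h1 : (r.factorial : ℚ) ≠ 0 := by positivity
    have h2 : ((n + i + q).factorial : ℚ) ≠ 0 := by positivity
    push_cast
    field_simp
  · rw [Nat.choose_eq_zero_of_lt (by omega)]
    obtain ⟨r, hr⟩ := Nat.exists_eq_add_of_lt h
    have hr' : (q : ℚ) = n + i + r + 1 := by exact_mod_cast hr
    rw [poch_eq_zero (x := (n : ℚ) + i + 1 - q) (j := r) (by omega) (by rw [hr']; ring)]
    simp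

lemma sum_jacobiCoeff_mul_choose {n : ℕ} (k q : ℕ) :
    ∑ i ∈ Finset.range (k + 1), jacobiCoeff n k i * ((2 * (n + i)).choose (n + i + q) : ℚ) =
      jacobiLaurent n k q := by
  rcases lt_or_ge (n + k) q with hq | hq
  · rw [jacobiLaurent, Nat.choose_eq_zero_of_lt (by omega), Nat.cast_zero, mul_zero]
    refine Finset.sum_eq_zero fun i hi => ?_
    have := Finset.mem_range.1 hi
    rw [Nat.choose_eq_zero_of_lt (by omega), Nat.cast_zero, mul_zero]
  have h1 : ((n + k + q).factorial : ℚ) * ((n + k - q).factorial : ℚ) ≠ 0 := by positivity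
  refine mul_right_cancel₀ h1 ?_
  have hR := choose_mul_factorial_mul_factorial (n := n) (le_refl k) hq
  simp only [Nat.sub_self, poch_zero, mul_one] at hR
  have hS := saalschutz k (k + n) (n + 1) (q - k - n)
  have h2 : ((2 * (n + k)).factorial : ℚ) ≠ 0 := by positivity
  rw [jacobiLaurent, mul_assoc, hR, div_mul_cancel₀ _ h2, Finset.sum_mul,
    show (q : ℚ) + 1 - k = n + 1 + (q - k - n) by ring,
    show poch (q : ℚ) k = poch ((k : ℚ) + n + (q - k - n)) k by ring_nf,
    mul_assoc ((-1) ^ k), mul_comm (poch _ k), ← hS, Finset.mul_sum, Finset.sum_mul]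
  refine Finset.sum_congr rfl fun i hi => ?_
  have hik : i ≤ k := Finset.mem_range_succ_iff.1 hi
  rw [mul_assoc, choose_mul_factorial_mul_factorial hik hq, factorial_two_mul_add, jacobiCoeff]
  have h3 : poch ((n : ℚ) + 1 / 2) i ≠ 0 := (poch_pos (by positivity) i).ne'
  have e1 := poch_neg ((n : ℚ) + i + 1 - q) (k - i)
  obtain ⟨j, rfl⟩ := Nat.exists_eq_add_of_le hik
  rw [Nat.add_sub_cancel_left] at e1 ⊢
  rw [show 1 - ((n : ℚ) + i + 1 - q) - j = q - (i + j : ℕ) - n by push_cast; ring] at e1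
  rw [e1, show ((i + j : ℕ) : ℚ) + n + (n + 1) + (q - (i + j : ℕ) - n) + i = n + i + q + 1 by
    push_cast; ring, pow_add]
  have e2 : ((-1 : ℚ) ^ j) * (-1) ^ j = 1 := by rw [← mul_pow]; simp
  generalize poch ((n : ℚ) + 1 / 2) i = P at *
  generalize (-1 : ℚ) ^ j = ε at *
  field_simp
  linear_combination (-(((i + j).choose i : ℚ) * poch ((i + j : ℕ) + n) i * poch (n + 1) i *
    poch (n + i + q + 1) j * poch (n + i + 1 - q) j)) * e2

lemma sum_jacobiCoeff_mul_centralBinom {n s d : ℕ} (hn : n = s + d) (k : ℕ) :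
    ∑ i ∈ Finset.range (k + 1), jacobiCoeff n k i * ((2 * (d + i)).choose (d + i) : ℚ) =
      ((2 * d).choose d : ℚ) * (poch s k * poch (1 / 2) k) /
        (poch (d + 1) k * poch (n + 1 / 2) k) := by
  have h1 : poch ((d : ℚ) + 1) k ≠ 0 := (poch_pos (by positivity) k).ne'
  have h2 : poch ((n : ℚ) + 1 / 2) k ≠ 0 := (poch_pos (by positivity) k).ne'
  have hS := saalschutz k (k + n) (d + 1 / 2) (1 / 2 - k - n)
  have hn' : (n : ℚ) = s + d := by exact_mod_cast hn
  have e0 := poch_neg (s : ℚ) k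
  rw [eq_div_iff (mul_ne_zero h1 h2)]
  have e2 (j : ℕ) : ((-1 : ℚ) ^ j) * (-1) ^ j = 1 := by rw [← mul_pow]; simp
  rw [show (k : ℚ) + n + (1 / 2 - k - n) = 1 / 2 by ring,
    show (d : ℚ) + 1 / 2 + (1 / 2 - k - n) = 1 - s - k by rw [hn']; ring, e0] at hS
  have hS' : poch (s : ℚ) k * poch (1 / 2) k = (-1) ^ k * (poch (1 / 2) k *
      ((-1) ^ k * poch (s : ℚ) k)) := by linear_combination -(poch (s : ℚ) k * poch (1 / 2) k) * e2 k
  rw [hS', ← hS, Finset.mul_sum, Finset.mul_sum, Finset.sum_mul]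
  refine Finset.sum_congr rfl fun i hi => ?_
  have hik : i ≤ k := Finset.mem_range_succ_iff.1 hi
  obtain ⟨j, rfl⟩ := Nat.exists_eq_add_of_le hik
  rw [choose_central_add, jacobiCoeff, Nat.add_sub_cancel_left, poch_add _ i j, poch_add _ i j]
  have e1 := poch_neg ((n : ℚ) + 1 / 2 + i) j
  rw [show 1 - ((n : ℚ) + 1 / 2 + i) - j = 1 / 2 - (i + j : ℕ) - n by push_cast; ring] at e1
  rw [e1, show ((i + j : ℕ) : ℚ) + n + (d + 1 / 2) + (1 / 2 - (i + j : ℕ) - n) + i = d + 1 + i by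
    push_cast; ring, pow_add]
  have h3 : poch ((n : ℚ) + 1 / 2) i ≠ 0 := (poch_pos (by positivity) i).ne'
  have h4 : poch ((d : ℚ) + 1) i ≠ 0 := (poch_pos (by positivity) i).ne'
  have e2j := e2 j
  generalize poch ((n : ℚ) + 1 / 2) i = P at *
  generalize poch ((n : ℚ) + 1 / 2 + i) j = P' at *
  generalize poch ((d : ℚ) + 1 / 2) i = P'' at *
  generalize (-1 : ℚ) ^ j = ε at *
  field_simp
  linear_combination (-(((i + j).choose i : ℚ) * poch ((i + j : ℕ) + n) i *
    ((2 * d).choose d : ℚ) * P'' * poch (d + 1 + i) j * P')) * e2j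

end Jacobi

section Dixon

lemma choose_two_mul_succ (M q : ℕ) :
    ((2 * (M + 1)).choose (M + 1 + q) : ℚ) * (((M : ℚ) + 1) ^ 2 - q ^ 2) =
      (2 * M + 2) * (2 * M + 1) * ((2 * M).choose (M + q) : ℚ) := by
  rcases le_or_gt q M with h | h
  · obtain ⟨r, rfl⟩ := Nat.exists_eq_add_of_le h
    rw [Nat.cast_choose ℚ (by omega), Nat.cast_choose ℚ (by omega),
      show 2 * (q + r + 1) - (q + r + 1 + q) = r + 1 by omega,
      show 2 * (q + r) - (q + r + q) = r by omega,
      show 2 * (q + r + 1) = 2 * (q + r) + 1 + 1 by ring,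
      show q + r + 1 + q = q + r + q + 1 by ring]
    simp only [Nat.factorial_succ]
    have h1 : (r.factorial : ℚ) ≠ 0 := by positivity
    have h2 : ((q + r + q).factorial : ℚ) ≠ 0 := by positivity
    push_cast
    field_simp
    ring
  · rw [Nat.choose_eq_zero_of_lt (by omega : 2 * M < M + q)]
    rcases eq_or_ne q (M + 1) with rfl | h'
    · push_cast; ring
    · rw [Nat.choose_eq_zero_of_lt (by omega)]; simp

lemma jacobiLaurent_succ (n k q : ℕ) :
    jacobiLaurent n (k + 1) q * (((n : ℚ) + k + 1) ^ 2 - q ^ 2) =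
      ((k : ℚ) ^ 2 - q ^ 2) * jacobiLaurent n k q := by
  have hc := choose_two_mul_succ (n + k) q
  have hp : poch ((q : ℚ) + 1 - (k + 1 : ℕ)) (k + 1) = (q - k) * poch (q + 1 - k) k := by
    rw [poch_succ_left]; push_cast; ring_nf
  have h1 : ((2 * (n + k)).factorial : ℚ) ≠ 0 := by positivity
  have h2 : (2 * ((n : ℚ) + k) + 1 + 1) ≠ 0 := by positivity
  have h3 : (2 * ((n : ℚ) + k) + 1) ≠ 0 := by positivity
  rw [jacobiLaurent, jacobiLaurent, hp, poch_succ (q : ℚ), pow_succ, ← add_assoc n k 1,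
    show 2 * (n + k + 1) = 2 * (n + k) + 1 + 1 by ring, Nat.factorial_succ, Nat.factorial_succ]
  rw [show 2 * (n + k + 1) = 2 * (n + k) + 1 + 1 by ring] at hc
  generalize (2 * (n + k)).factorial = f at *
  push_cast at hc ⊢
  field_simp
  linear_combination (poch ((q : ℚ) + 1 - k) k * poch (q : ℚ) k *
    (-(q - k) * (q + k))) * hc

/-- The well-poised factor of the Dixon type sums. -/
def wellPoised (n k : ℕ) : ℚ := poch n k * (n + 2 * k) / (n * (k.factorial : ℚ))

lemma wellPoised_zero {n : ℕ} (hn : 0 < n) : wellPoised n 0 = 1 := by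
  have : (n : ℚ) ≠ 0 := by positivity
  simp [wellPoised, poch_zero, this]

lemma wellPoised_succ {n : ℕ} (hn : 0 < n) (k : ℕ) :
    wellPoised n (k + 1) =
      poch (n + 1) k * (n + 2 * k + 2) / ((k + 1) * (k.factorial : ℚ)) := by
  have : (n : ℚ) ≠ 0 := by positivity
  have h2 : (k.factorial : ℚ) ≠ 0 := by positivity
  rw [wellPoised, poch_succ_left, Nat.factorial_succ]
  push_cast
  field_simp
  ring

lemma sum_wellPoised_telescope {n s d : ℕ} (hn : n = s + 1 + d) (q K : ℕ) :
    ∑ k ∈ Finset.range (K + 1), wellPoised n k * jacobiLaurent n k q *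
      ((((s : ℚ) + 1) ^ 2 - q ^ 2) * (poch d k / poch (s + 2) k) -
        ((s : ℚ) + 1) ^ 2 * (poch (d + 1) k / poch (s + 1) k)) =
      poch (n + 1) K * poch (d + 1) K / ((K.factorial : ℚ) * poch (s + 2) K) *
        ((K : ℚ) ^ 2 - q ^ 2) * jacobiLaurent n K q := by
  have hn' : (n : ℚ) = s + 1 + d := by exact_mod_cast hn
  induction K with
  | zero => simp [wellPoised_zero (by omega : 0 < n), poch_zero]; ring
  | succ K ih =>
    have h1 : poch ((s : ℚ) + 2) K ≠ 0 := (poch_pos (by positivity) K).ne'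
    have h2 : (K.factorial : ℚ) ≠ 0 := by positivity
    have h3 : (s : ℚ) + 2 + K ≠ 0 := by positivity
    have h4 : (s : ℚ) + 1 ≠ 0 := by positivity
    have h5 : (K : ℚ) + 1 ≠ 0 := by positivity
    rw [Finset.sum_range_succ, ih, wellPoised_succ (by omega), Nat.factorial_succ,
      mul_assoc _ _ (jacobiLaurent n K q), ← jacobiLaurent_succ, poch_succ_left (d : ℚ),
      poch_succ_left ((s : ℚ) + 1), poch_succ _ K, poch_succ _ K, poch_succ _ K,
      show (s : ℚ) + 1 + 1 = s + 2 by ring]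
    generalize jacobiLaurent n (K + 1) q = L
    generalize poch ((s : ℚ) + 2) K = P at *
    generalize poch ((n : ℚ) + 1) K = P'
    generalize poch ((d : ℚ) + 1) K = P''
    rw [hn']
    push_cast
    field_simp
    ring

lemma jacobiLaurent_eq_zero {n k q : ℕ} (h : q < k) : jacobiLaurent n k q = 0 := by
  obtain ⟨r, rfl⟩ := Nat.exists_eq_add_of_lt h
  rw [jacobiLaurent, poch_eq_zero (x := (q : ℚ) + 1 - (q + r + 1 : ℕ)) (j := r) (by omega)
    (by push_cast; ring)]
  simp

lemma jacobiLaurent_zero (n q : ℕ) :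
    jacobiLaurent n 0 q = ((2 * n).choose (n + q) : ℚ) := by
  have : ((2 * n).factorial : ℚ) ≠ 0 := by positivity
  simp [jacobiLaurent, poch_zero, this]

lemma sum_wellPoised_mul_jacobiLaurent {n s d : ℕ} (hpos : 0 < n) (hn : n = s + d) (q : ℕ) :
    ((2 * s).choose s : ℚ) * ∑ k ∈ Finset.range (q + 1), wellPoised n k * jacobiLaurent n k q *
      (poch d k / poch (s + 1) k) = ((2 * n).choose n : ℚ) * ((2 * s).choose (s + q) : ℚ) := by
  induction d generalizing s with
  | zero =>
    rw [Finset.sum_range_succ', Finset.sum_eq_zero fun i _ => ?_]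
    · simp only [wellPoised_zero hpos]
      simp [poch_zero, jacobiLaurent_zero, hn]
    · simp [poch_succ_left]
  | succ d ih =>
    have ih' := ih (s := s + 1) (by omega)
    have tel := sum_wellPoised_telescope (n := n) (s := s) (d := d) (by omega) q q
    have c0 := choose_two_mul_succ s 0
    have cq := choose_two_mul_succ s q
    rw [show ((s + 1 : ℕ) : ℚ) + 1 = s + 2 by push_cast; ring] at ih'
    rw [sub_self, mul_zero, zero_mul] at tel
    simp only [mul_sub, Finset.sum_sub_distrib] at tel
    simp only [mul_left_comm (wellPoised n _ * jacobiLaurent n _ q), ← Finset.mul_sum] at tel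
    push_cast at *
    set S := ∑ k ∈ Finset.range (q + 1), wellPoised n k * jacobiLaurent n k q *
      (poch ((d : ℚ) + 1) k / poch (s + 1) k)
    set S' := ∑ k ∈ Finset.range (q + 1), wellPoised n k * jacobiLaurent n k q *
      (poch (d : ℚ) k / poch (s + 2) k)
    have h0 : ((2 * (s + 1)).choose (s + 1) : ℚ) ≠ 0 := by
      exact_mod_cast (Nat.choose_pos (by omega)).ne'
    have h1 : (2 * (s : ℚ) + 2) * (2 * s + 1) ≠ 0 := by positivity
    refine mul_left_cancel₀ h1 ?_
    simp only [add_zero] at c0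
    linear_combination (-S) * c0 - ((2 * (s + 1)).choose (s + 1) : ℚ) * tel +
      (((s : ℚ) + 1) ^ 2 - q ^ 2) * ih' + ((2 * n).choose n : ℚ) * cq

end Dixon

section HoleProbability

lemma choose_add_mul_factorial (a k : ℕ) :
    ((k + a).choose k : ℚ) * (k.factorial : ℚ) = poch (a + 1) k := by
  have h1 : (a.factorial : ℚ) ≠ 0 := by positivity
  have h2 : (k.factorial : ℚ) ≠ 0 := by positivity
  have h3 := factorial_mul_poch a k
  rw [Nat.cast_choose ℚ (by omega), Nat.add_sub_cancel_left, add_comm k a, ← h3]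
  field_simp

lemma poch_two_mul (x : ℚ) (k : ℕ) :
    poch (2 * x) (2 * k) = 4 ^ k * poch x k * poch (x + 1 / 2) k := by
  induction k with
  | zero => simp [poch_zero]
  | succ k ih =>
    rw [show 2 * (k + 1) = 2 * k + 1 + 1 by ring, poch_succ, poch_succ, ih, poch_succ, poch_succ]
    push_cast; ring

lemma prefactor_eq (M p : ℕ) :
    ((p + 1 : ℕ) : ℚ) * ((p + 1 + (M + 1)).choose (p + 1) : ℚ) *
        ((p + 1 + (M + 1) - 1).choose (p + 1) : ℚ) /
          ((2 * (p + 1) + 2 * (M + 1) - 1).choose (2 * (p + 1)) : ℚ) =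
      poch (M + 2) (p + 1) * poch (1 / 2) (p + 1) /
        ((p.factorial : ℚ) * poch (M + 3 / 2) (p + 1)) := by
  have e1 := choose_add_mul_factorial (M + 1) (p + 1)
  have e2 := choose_add_mul_factorial M (p + 1)
  have e3 := choose_add_mul_factorial (2 * M + 1) (2 * (p + 1))
  have e4 := poch_two_mul (M + 1) (p + 1)
  rw [show 2 * ((M : ℚ) + 1) = ((2 * M + 1 : ℕ) : ℚ) + 1 by push_cast; ring, ← e3,
    ← e2, factorial_two_mul, show (M : ℚ) + 1 + 1 / 2 = M + 3 / 2 by ring] at e4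
  rw [show ((M + 1 : ℕ) : ℚ) + 1 = M + 2 by push_cast; ring] at e1
  rw [show p + 1 + (M + 1) - 1 = p + 1 + M by omega,
    show 2 * (p + 1) + 2 * (M + 1) - 1 = 2 * (p + 1) + (2 * M + 1) by omega, ← e1]
  have h0 : poch ((M : ℚ) + 3 / 2) (p + 1) ≠ 0 := (poch_pos (by positivity) _).ne'
  have h1 : (((p + 1).factorial : ℕ) : ℚ) ≠ 0 := by positivity
  have h2 : (p.factorial : ℚ) ≠ 0 := by positivity
  have h3 : ((2 * (p + 1) + (2 * M + 1)).choose (2 * (p + 1)) : ℚ) ≠ 0 := by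
    exact_mod_cast (Nat.choose_pos (by omega)).ne'
  have h4 : (4 : ℚ) ^ (p + 1) ≠ 0 := by positivity
  rw [div_eq_div_iff h3 (mul_ne_zero h2 h0)]
  have h5 : (((p + 1).factorial : ℕ) : ℚ) = (p + 1) * p.factorial := by
    rw [Nat.factorial_succ]; push_cast; ring
  refine mul_left_cancel₀ (mul_ne_zero h4 h1) ?_
  generalize (((p + 1).factorial : ℕ) : ℚ) = F at *
  push_cast
  linear_combination (-((p + 1 + (M + 1)).choose (p + 1) : ℚ) * F) * e4 -
    (4 ^ (p + 1) * F * ((p + 1 + (M + 1)).choose (p + 1) : ℚ) *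
      ((p + 1 + M).choose (p + 1) : ℚ) * poch (M + 3 / 2) (p + 1)) * h5

/-- The contribution of the `k`-th orthogonal polynomial to the probability that the central
position at height `2 * s` on the axis is crossed by a path. -/
def holeTerm (n s d k : ℕ) : ℚ :=
  ((2 * s).choose s : ℚ) / ((2 * n).choose n : ℚ) * wellPoised n k *
    (poch d k / poch (s + 1) k) *
    (((2 * d).choose d : ℚ) * (poch s k * poch (1 / 2) k) / (poch (d + 1) k * poch (n + 1 / 2) k))

/-- The part of the summand that does not depend on `m`. -/
def axisWeight (N l : ℕ) : ℚ :=
  (-1) ^ l * (N.choose l : ℚ) * poch (1 / 2) l / poch (1 / 2 - N) l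

lemma axisWeight_eq (l r : ℕ) :
    axisWeight (l + r) l = ((l + r).factorial : ℚ) * poch (1 / 2) l /
      ((l.factorial : ℚ) * (r.factorial : ℚ) * poch (r + 1 / 2) l) := by
  have e := poch_neg ((r : ℚ) + 1 / 2) l
  rw [show 1 - ((r : ℚ) + 1 / 2) - l = 1 / 2 - (l + r : ℕ) by push_cast; ring] at e
  have h0 : poch ((r : ℚ) + 1 / 2) l ≠ 0 := (poch_pos (by positivity) _).ne'
  have h1 : (l.factorial : ℚ) ≠ 0 := by positivity
  have h2 : (r.factorial : ℚ) ≠ 0 := by positivity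
  have h3 : (-1 : ℚ) ^ l ≠ 0 := by positivity
  rw [axisWeight, e, Nat.cast_choose ℚ (by omega), Nat.add_sub_cancel_left]
  generalize poch ((r : ℚ) + 1 / 2) l = P at *
  field_simp

lemma centralBinom_ratio_left (l r : ℕ) :
    ((2 * (r + 1)).choose (r + 1) : ℚ) / ((2 * (l + r + 1)).choose (l + r + 1) : ℚ) *
      ((2 * l).choose l : ℚ) =
    axisWeight (l + r) l * ((l + r + 1) * (r + 1 / 2)) / ((r + 1) * (l + r + 1 / 2)) := by
  rw [axisWeight_eq, cast_centralBinom_choose, cast_centralBinom_choose, cast_centralBinom_choose,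
    poch_succ _ (l + r), add_comm l r, poch_add _ r l, poch_succ _ r, Nat.factorial_succ,
    Nat.factorial_succ, add_comm (1 / 2 : ℚ) r]
  have h0 : poch ((r : ℚ) + 1 / 2) l ≠ 0 := (poch_pos (by positivity) _).ne'
  have h3 : poch (1 / 2 : ℚ) r ≠ 0 := (poch_pos (by positivity) _).ne'
  have h1 : (l.factorial : ℚ) ≠ 0 := by positivity
  have h2 : (r.factorial : ℚ) ≠ 0 := by positivity
  have h4 : ((r + l).factorial : ℚ) ≠ 0 := by positivity
  have h5 : (r : ℚ) + l + 1 / 2 ≠ 0 := by positivity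
  have h6 : 1 + 2 * ((r : ℚ) + l) ≠ 0 := by positivity
  generalize poch ((r : ℚ) + 1 / 2) l = P at *
  generalize poch (1 / 2 : ℚ) r = P' at *
  generalize poch (1 / 2 : ℚ) l = P'' at *
  push_cast
  field_simp
  ring

lemma centralBinom_ratio_right (l r : ℕ) :
    ((2 * r).choose r : ℚ) / ((2 * (l + r + 1)).choose (l + r + 1) : ℚ) *
      ((2 * (l + 1)).choose (l + 1) : ℚ) =
    axisWeight (l + r) l * ((l + r + 1) * (l + 1 / 2)) / ((l + 1) * (l + r + 1 / 2)) := by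
  rw [axisWeight_eq, cast_centralBinom_choose, cast_centralBinom_choose, cast_centralBinom_choose,
    poch_succ _ (l + r), add_comm l r, poch_add _ r l, poch_succ _ l, Nat.factorial_succ,
    Nat.factorial_succ, add_comm (1 / 2 : ℚ) r]
  have h0 : poch ((r : ℚ) + 1 / 2) l ≠ 0 := (poch_pos (by positivity) _).ne'
  have h3 : poch (1 / 2 : ℚ) r ≠ 0 := (poch_pos (by positivity) _).ne'
  have h1 : (l.factorial : ℚ) ≠ 0 := by positivity
  have h2 : (r.factorial : ℚ) ≠ 0 := by positivity
  have h4 : ((r + l).factorial : ℚ) ≠ 0 := by positivity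
  have h5 : (r : ℚ) + l + 1 / 2 ≠ 0 := by positivity
  have h6 : 1 + 2 * ((r : ℚ) + l) ≠ 0 := by positivity
  generalize poch ((r : ℚ) + 1 / 2) l = P at *
  generalize poch (1 / 2 : ℚ) r = P' at *
  generalize poch (1 / 2 : ℚ) l = P'' at *
  push_cast
  field_simp
  ring

lemma poch_div_poch_add_one (x k : ℕ) :
    poch x (k + 1) / poch (x + 1) (k + 1) = x / (x + k + 1) := by
  have h : poch ((x : ℚ) + 1) k ≠ 0 := (poch_pos (by positivity) _).ne'
  have h1 : (x : ℚ) + k + 1 ≠ 0 := by positivity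
  rw [poch_succ_left, poch_succ, show (x : ℚ) + 1 + k = x + k + 1 by ring]
  field_simp

lemma holeTerm_succ (n s d k : ℕ) :
    holeTerm n s d (k + 1) =
      ((2 * s).choose s : ℚ) / ((2 * n).choose n : ℚ) * ((2 * d).choose d : ℚ) *
        (wellPoised n (k + 1) * poch (1 / 2) (k + 1) / poch (n + 1 / 2) (k + 1)) *
        ((d / (d + k + 1)) * (s / (s + k + 1))) := by
  rw [← poch_div_poch_add_one, ← poch_div_poch_add_one, holeTerm]
  ring

/-- The factor of the final formula in front of the sum. -/
def axisPrefactor (n p : ℕ) : ℚ :=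
  poch n (p + 1) * poch (1 / 2) (p + 1) / ((p.factorial : ℚ) * poch (n - 1 / 2) (p + 1))

lemma sum_holeTerm_sub (l r p : ℕ) :
    ∑ k ∈ Finset.range (p + 1), (holeTerm (l + r + 1) (r + 1) l k -
        holeTerm (l + r + 1) r (l + 1) k) =
      axisPrefactor (l + r + 1) p * (axisWeight (l + r) l * ((r : ℚ) - l) /
        ((p + 1 + l) * (p + 1 + r))) := by
  induction p with
  | zero =>
    have e1 := centralBinom_ratio_left l r
    have e2 := centralBinom_ratio_right l r
    have h1 : (l : ℚ) + r + 1 / 2 ≠ 0 := by positivity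
    simp only [zero_add, Finset.sum_range_one, holeTerm, wellPoised_zero (Nat.succ_pos _),
      axisPrefactor, poch_zero, poch_succ, mul_one, div_one, Nat.factorial_zero, one_mul, e1, e2]
    push_cast
    rw [show (l : ℚ) + r + 1 - 1 / 2 + 0 = l + r + 1 / 2 by ring]
    have h2 : 2 * ((l : ℚ) + r) + 1 ≠ 0 := by positivity
    field_simp
    ring
  | succ p ih =>
    rw [Finset.sum_range_succ, ih, holeTerm_succ, holeTerm_succ, centralBinom_ratio_left,
      centralBinom_ratio_right, axisPrefactor, axisPrefactor, wellPoised_succ (Nat.succ_pos _),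
      poch_succ _ (p + 1), poch_succ (1 / 2) (p + 1),
      poch_succ (((l + r + 1 : ℕ) : ℚ) - 1 / 2) (p + 1), Nat.factorial_succ]
    have e1 : poch (((l + r + 1 : ℕ) : ℚ) + 1 / 2) (p + 1) = poch (((l + r + 1 : ℕ) : ℚ) - 1 / 2) (p + 1)
        * (l + r + p + 3 / 2) / (l + r + 1 / 2) := by
      have h1 : (l : ℚ) + r + 1 / 2 ≠ 0 := by positivity
      rw [eq_div_iff h1, poch_succ _ p, poch_succ_left _ p,
        show ((l + r + 1 : ℕ) : ℚ) - 1 / 2 + 1 = ((l + r + 1 : ℕ) : ℚ) + 1 / 2 by ring]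
      push_cast; ring
    have e2 : poch ((l + r + 1 : ℕ) : ℚ) (p + 1) =
        (l + r + 1) * poch (((l + r + 1 : ℕ) : ℚ) + 1) p := by
      rw [poch_succ_left]; push_cast; ring
    rw [e1, e2]
    have h0 : poch (((l + r + 1 : ℕ) : ℚ) - 1 / 2) (p + 1) ≠ 0 :=
      (poch_pos (by push_cast; linarith [(Nat.cast_nonneg l : (0 : ℚ) ≤ l),
        (Nat.cast_nonneg r : (0 : ℚ) ≤ r)]) _).ne'
    generalize poch (((l + r + 1 : ℕ) : ℚ) - 1 / 2) (p + 1) = P at *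
    generalize poch (((l + r + 1 : ℕ) : ℚ) + 1) p = P' at *
    generalize poch (1 / 2 : ℚ) (p + 1) = P'' at *
    generalize axisWeight (l + r) l = w at *
    have h2 : (p.factorial : ℚ) ≠ 0 := by positivity
    push_cast
    have g1 : (l : ℚ) + r + 1 / 2 ≠ 0 := by positivity
    have g2 : (l : ℚ) + r + p + 3 / 2 ≠ 0 := by positivity
    have g3 : (l : ℚ) + r + 1 - 1 / 2 + (p + 1) ≠ 0 := by
      rw [show (l : ℚ) + r + 1 - 1 / 2 + (p + 1) = l + r + p + 3 / 2 by ring]; exact g2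
    rw [show (l : ℚ) + r + 1 - 1 / 2 + (p + 1) = l + r + p + 3 / 2 by ring]
    have g4 : (l : ℚ) + r + 1 ≠ 0 := by positivity
    have g5 : 2 * ((l : ℚ) + r + p) + 3 ≠ 0 := by positivity
    have g6 : 2 * ((l : ℚ) + r) + 1 ≠ 0 := by positivity
    field_simp
    ring

lemma one_sub_sum_holeTerm (p : ℕ) {n s d : ℕ} (hn : 0 < n) (h : n = s + d) :
    1 - ∑ k ∈ Finset.range (p + 1), holeTerm n s d k =
      axisPrefactor n p * ∑ e ∈ Finset.range d, axisWeight (n - 1) e * ((n : ℚ) - 1 - 2 * e) /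
        ((p + 1 + e) * (p + n - e)) := by
  induction d generalizing s with
  | zero =>
    obtain rfl : n = s := by simpa using h
    have : ((2 * n).choose n : ℚ) ≠ 0 := by exact_mod_cast (Nat.choose_pos (by omega)).ne'
    rw [Finset.sum_range_succ', Finset.sum_eq_zero fun k _ => ?_]
    · simp [holeTerm, poch_zero, wellPoised_zero hn, this]
    · simp [holeTerm_succ]
  | succ d ih =>
    obtain rfl : n = d + s + 1 := by omega
    have ih' := ih (s := s + 1) (by omega)
    have hs := sum_holeTerm_sub d s p
    rw [Finset.sum_sub_distrib] at hs
    rw [Finset.sum_range_succ _ d, mul_add, ← ih']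
    simp only [Nat.add_sub_cancel]
    push_cast
    rw [show (d : ℚ) + s + 1 - 1 - 2 * d = s - d by ring,
      show (p : ℚ) + (d + s + 1) - d = p + 1 + s by ring]
    linear_combination hs

end HoleProbability

section RankOne

/-- The binomial coefficient with an integer lower index. -/
def chooseInt (k : ℕ) (t : ℤ) : ℚ := if 0 ≤ t then (k.choose t.toNat : ℚ) else 0

lemma chooseInt_natCast (k t : ℕ) : chooseInt k t = (k.choose t : ℚ) := by
  simp [chooseInt]

lemma chooseInt_of_neg (k : ℕ) {t : ℤ} (ht : t < 0) : chooseInt k t = 0 := by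
  simp [chooseInt, ht]

lemma chooseInt_zero (t : ℤ) : chooseInt 0 t = if t = 0 then 1 else 0 := by
  rcases lt_or_ge t 0 with ht | ht
  · rw [chooseInt_of_neg _ ht, if_neg ht.ne]
  · lift t to ℕ using ht
    rw [chooseInt_natCast]
    cases t with
    | zero => simp
    | succ t => simp [Nat.cast_add_one_ne_zero]

lemma chooseInt_succ (k : ℕ) (t : ℤ) :
    chooseInt (k + 1) t = chooseInt k t + chooseInt k (t - 1) := by
  rcases lt_or_ge t 0 with ht | ht
  · simp [chooseInt_of_neg _ ht, chooseInt_of_neg _ (show t - 1 < 0 by omega)]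
  · lift t to ℕ using ht
    cases t with
    | zero =>
      rw [chooseInt_of_neg k (show ((0 : ℕ) : ℤ) - 1 < 0 by simp), chooseInt_natCast,
        chooseInt_natCast]
      simp
    | succ t =>
      rw [show ((t + 1 : ℕ) : ℤ) - 1 = (t : ℕ) by push_cast; ring]
      simp only [chooseInt_natCast, Nat.choose_succ_succ']
      push_cast; ring

lemma chooseInt_sub (k : ℕ) (t : ℤ) : chooseInt k (k - t) = chooseInt k t := by
  induction k generalizing t with
  | zero => simp [chooseInt_zero]
  | succ k ih =>
    rw [chooseInt_succ, chooseInt_succ, show ((k + 1 : ℕ) : ℤ) - t = k - (t - 1) by push_cast; ring,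
      show (k : ℤ) - (t - 1) - 1 = k - t by ring, ih, ih, add_comm]

lemma chooseInt_central (n : ℕ) (x : ℤ) :
    chooseInt (2 * n) (n + x) = ((2 * n).choose (n + x.natAbs) : ℚ) := by
  rcases le_total 0 x with hx | hx
  · lift x to ℕ using hx
    exact_mod_cast chooseInt_natCast (2 * n) (n + x)
  · obtain ⟨y, rfl⟩ : ∃ y : ℕ, x = -y := ⟨x.natAbs, by omega⟩
    rw [← chooseInt_sub, show ((2 * n : ℕ) : ℤ) - (n + -y) = (n + y : ℕ) by push_cast; ring,
      chooseInt_natCast]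
    simp

lemma sum_chooseInt_mul_chooseInt (a b : ℕ) (t : ℤ) {c L : ℕ} (h : b + c < L) :
    ∑ r ∈ Finset.range L, chooseInt a (t - r) * chooseInt b (r - c) = chooseInt (a + b) (t - c) := by
  induction b generalizing c with
  | zero =>
    rw [Finset.sum_eq_single_of_mem c (Finset.mem_range.2 (by omega))]
    · simp [chooseInt_zero]
    · intro r _ hr
      rw [chooseInt_zero, if_neg (by omega), mul_zero]
  | succ b ih =>
    have h1 := ih (c := c) (by omega)
    have h2 := ih (c := c + 1) (by omega)
    rw [← add_assoc, chooseInt_succ (a + b), ← h1, show t - (c : ℤ) - 1 = t - (c + 1 : ℕ) by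
      push_cast; ring, ← h2, ← Finset.sum_add_distrib]
    refine Finset.sum_congr rfl fun r _ => ?_
    rw [chooseInt_succ, show (r : ℤ) - c - 1 = r - (c + 1 : ℕ) by push_cast; ring, mul_add]

/-- The solution of the linear system expressing the central binomial coefficients
`C(2s, s + q)` through the Toeplitz matrix of the coefficients `C(2n, n + q)`. -/
def holeVector (n s d p : ℕ) (r : ℕ) : ℚ :=
  ∑ k ∈ Finset.range (p + 1), ((2 * s).choose s : ℚ) / ((2 * n).choose n : ℚ) * wellPoised n k *
    (poch d k / poch (s + 1) k) *
    ∑ i ∈ Finset.range (k + 1), jacobiCoeff n k i * chooseInt (2 * i) (r - (p - i : ℕ))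

lemma sum_chooseInt_mul_holeVector (n s d p t : ℕ) (x : ℤ) :
    ∑ r ∈ Finset.range (2 * p + 1), chooseInt (2 * t) (t + (p + x) - r) * holeVector n s d p r =
      ∑ k ∈ Finset.range (p + 1), ((2 * s).choose s : ℚ) / ((2 * n).choose n : ℚ) *
        wellPoised n k * (poch d k / poch (s + 1) k) * ∑ i ∈ Finset.range (k + 1),
          jacobiCoeff n k i * ((2 * (t + i)).choose (t + i + x.natAbs) : ℚ) := by
  simp_rw [holeVector, Finset.mul_sum]
  rw [Finset.sum_comm]
  refine Finset.sum_congr rfl fun k hk => ?_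
  rw [Finset.sum_comm]
  refine Finset.sum_congr rfl fun i hi => ?_
  rw [Finset.mem_range] at hk hi
  have h := sum_chooseInt_mul_chooseInt (2 * t) (2 * i) (t + (p + x)) (c := p - i) (L := 2 * p + 1)
    (by omega)
  rw [← mul_add, show (t : ℤ) + (p + x) - (p - i : ℕ) = (t + i : ℕ) + x by omega,
    chooseInt_central] at h
  rw [← h]
  simp_rw [Finset.mul_sum]
  refine Finset.sum_congr rfl fun r _ => ?_
  ring

lemma sum_toeplitz_mul_holeVector {n s d p : ℕ} (hpos : 0 < n) (hn : n = s + d) {x : ℤ}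
    (hx : x.natAbs ≤ p) :
    ∑ r ∈ Finset.range (2 * p + 1), chooseInt (2 * n) (n + (p + x) - r) * holeVector n s d p r =
      chooseInt (2 * s) (s + x) := by
  have hc : ((2 * n).choose n : ℚ) ≠ 0 := by exact_mod_cast (Nat.choose_pos (by omega)).ne'
  have h := sum_wellPoised_mul_jacobiLaurent hpos hn x.natAbs
  rw [sum_chooseInt_mul_holeVector, chooseInt_central]
  simp_rw [sum_jacobiCoeff_mul_choose]
  rw [← Finset.sum_subset (Finset.range_mono (Nat.succ_le_succ hx)) fun k _ hk => ?_]
  · rw [eq_comm, ← mul_right_inj' hc, ← h, Finset.mul_sum, Finset.mul_sum]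
    refine Finset.sum_congr rfl fun k _ => ?_
    field_simp
  · rw [jacobiLaurent_eq_zero (by simpa using hk), mul_zero]

lemma sum_holeVector_mul_central {n s d : ℕ} (hn : n = s + d) (p : ℕ) :
    ∑ r ∈ Finset.range (2 * p + 1), chooseInt (2 * d) (d + p - r) * holeVector n s d p r =
      ∑ k ∈ Finset.range (p + 1), holeTerm n s d k := by
  have h := sum_chooseInt_mul_holeVector n s d p d 0
  simp only [add_zero, Int.natAbs_zero] at h
  simp_rw [h, sum_jacobiCoeff_mul_centralBinom hn, holeTerm]

lemma det_sub_vecMulVec_vecMul {ι : Type*} [Fintype ι] [DecidableEq ι] (M : Matrix ι ι ℚ)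
    (u v : ι → ℚ) : (M - Matrix.vecMulVec v (Matrix.vecMul u M)).det = (1 - u ⬝ᵥ v) * M.det := by
  have h : M - Matrix.vecMulVec v (Matrix.vecMul u M) =
      (1 + Matrix.replicateCol Unit (-v) * Matrix.replicateRow Unit u) * M := by
    rw [Matrix.add_mul, Matrix.one_mul]
    ext i j
    simp [Matrix.vecMulVec_apply, Matrix.mul_apply, Matrix.vecMul, dotProduct, Finset.mul_sum,
      mul_assoc, sub_eq_add_neg]
  rw [h, Matrix.det_mul, Matrix.det_one_add_replicateCol_mul_replicateRow]
  simp [sub_eq_add_neg]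

lemma det_toeplitz_sub {n s d : ℕ} (hpos : 0 < n) (hn : n = s + d) (p : ℕ) :
    (Matrix.of fun i j : Fin (2 * p + 1) => chooseInt (2 * n) (n + j - i) -
      chooseInt (2 * s) (s + j - p) * chooseInt (2 * d) (d + p - i)).det =
    (1 - ∑ k ∈ Finset.range (p + 1), holeTerm n s d k) *
      (Matrix.of fun i j : Fin (2 * p + 1) => chooseInt (2 * n) (n + j - i)).det := by
  have hd := det_sub_vecMulVec_vecMul
    (Matrix.of fun i j : Fin (2 * p + 1) => chooseInt (2 * n) (n + j - i))
    (fun r => holeVector n s d p r) (fun i => chooseInt (2 * d) (d + p - i))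
  rw [← sum_holeVector_mul_central hn]
  convert hd using 2
  · ext i j
    have h := sum_toeplitz_mul_holeVector hpos hn (p := p) (x := (j : ℤ) - p) (by omega)
    rw [← Fin.sum_univ_eq_sum_range (fun r => chooseInt (2 * n) (n + (p + ((j : ℤ) - p)) - r) *
      holeVector n s d p r)] at h
    simp only [Matrix.of_apply, Matrix.sub_apply, Matrix.vecMulVec_apply, Matrix.vecMul,
      dotProduct]
    rw [show (s : ℤ) + j - p = s + ((j : ℤ) - p) by ring, ← h,
      mul_comm _ (chooseInt (2 * d) _)]
    congr 2
    refine Finset.sum_congr rfl fun r _ => ?_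
    rw [mul_comm, show (n : ℤ) + (p + ((j : ℤ) - p)) - r = n + j - r by ring]
  · rw [← Fin.sum_univ_eq_sum_range (fun r => chooseInt (2 * d) ((d : ℤ) + p - r) *
      holeVector n s d p r)]
    simp only [dotProduct]
    congr 1
    exact Finset.sum_congr rfl fun r _ => mul_comm _ _

end RankOne

section MacMahon

lemma det_toeplitz_eq_det_choose (n A : ℕ) :
    (Matrix.of fun i j : Fin A => chooseInt (2 * n) (n + j - i)).det =
      (Matrix.of fun i j : Fin A => ((2 * n + j).choose (n + i) : ℚ)).det := by
  have hU : (Matrix.of fun k j : Fin A => ((j : ℕ).choose k : ℚ)).det = 1 := by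
    rw [Matrix.det_of_isUpperTriangular fun i j (hij : j < i) => by
      simp [Nat.choose_eq_zero_of_lt (Fin.lt_def.1 hij)]]
    simp
  rw [← mul_one (Matrix.det _), ← hU, ← Matrix.det_mul]
  congr 1
  ext i j
  have h := sum_chooseInt_mul_chooseInt (2 * n) j (n + i) (c := 0) (L := A) (by omega)
  rw [← Fin.sum_univ_eq_sum_range (fun r => chooseInt (2 * n) ((n : ℤ) + i - r) *
    chooseInt j (r - (0 : ℕ)))] at h
  simp only [Nat.cast_zero, sub_zero, chooseInt_natCast] at h
  rw [Matrix.mul_apply, Matrix.of_apply, ← chooseInt_natCast, Nat.cast_add, ← h]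
  refine Finset.sum_congr rfl fun k _ => ?_
  rw [Matrix.of_apply, Matrix.of_apply, ← chooseInt_sub]
  congr 2
  push_cast; ring

lemma choose_rev_eq {n A i j : ℕ} (hi : i ≤ A) (hj : j ≤ A) :
    ((2 * n + (A - j)).choose (n + (A - i)) : ℚ) =
      1 / (((n + (A - i)).factorial : ℚ) * ((n + i).factorial : ℚ)) *
        (((2 * n + (A - j)).factorial : ℚ) * ((n + i).descFactorial j : ℚ)) := by
  have h1 : ((n + (A - i)).factorial : ℚ) ≠ 0 := by positivity
  have h2 : ((n + i).factorial : ℚ) ≠ 0 := by positivity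
  rcases lt_or_ge (n + i) j with h | h
  · rw [Nat.choose_eq_zero_of_lt (by omega), Nat.descFactorial_of_lt h]
    simp
  · have h3 : ((n + i - j).factorial : ℚ) ≠ 0 := by positivity
    rw [Nat.cast_choose ℚ (by omega), ← Nat.factorial_mul_descFactorial h,
      show 2 * n + (A - j) - (n + (A - i)) = n + i - j by omega]
    rw [← Nat.factorial_mul_descFactorial h] at h2
    push_cast at h2 ⊢
    have h4 := right_ne_zero_of_mul h2
    field_simp

lemma det_descFactorial (n A : ℕ) :
    (Matrix.of fun i j : Fin (A + 1) => ((n + i : ℕ).descFactorial j : ℚ)).det =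
      ∏ j ∈ Finset.range (A + 1), (j.factorial : ℚ) := by
  have h := Matrix.det_eval_matrixOfPolynomials_eq_det_vandermonde
    (fun i : Fin (A + 1) => ((n + i : ℕ) : ℚ)) (fun j => descPochhammer ℚ j)
    (fun j => descPochhammer_natDegree ℚ j) (fun j => monic_descPochhammer ℚ j)
  simp only [descPochhammer_eval_eq_descFactorial] at h
  rw [← h, ← Nat.cast_prod, Nat.prod_range_succ_factorial,
    ← Matrix.det_vandermonde_id_eq_superFactorial,
    ← Matrix.det_vandermonde_add (fun i : Fin (A + 1) => (i : ℚ)) n]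
  congr 2
  ext i
  push_cast
  ring

lemma det_toeplitz (n A : ℕ) :
    (Matrix.of fun i j : Fin (A + 1) => chooseInt (2 * n) (n + j - i)).det =
      ∏ k ∈ Finset.range (A + 1), ((2 * n + k).factorial : ℚ) * (k.factorial : ℚ) /
        ((n + k).factorial : ℚ) ^ 2 := by
  have hrev : (Matrix.of fun i j : Fin (A + 1) => ((2 * n + j).choose (n + i) : ℚ)).det =
      (Matrix.of fun i j : Fin (A + 1) =>
        1 / (((n + (A - i)).factorial : ℚ) * ((n + i).factorial : ℚ)) *
          (Matrix.of fun i j : Fin (A + 1) => ((2 * n + (A - j)).factorial : ℚ) *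
            (Matrix.of fun i j : Fin (A + 1) => ((n + i : ℕ).descFactorial j : ℚ)) i j) i j).det := by
    rw [← Matrix.det_submatrix_equiv_self Fin.revPerm]
    congr 1
    ext i j
    simp only [Matrix.submatrix_apply, Matrix.of_apply, Fin.revPerm_apply, Fin.val_rev]
    rw [← choose_rev_eq (by omega) (by omega)]
    congr 2 <;> omega
  rw [det_toeplitz_eq_det_choose, hrev, Matrix.det_mul_column, Matrix.det_mul_row,
    det_descFactorial, Fin.prod_univ_eq_prod_range
      (fun i => 1 / (((n + (A - i)).factorial : ℚ) * ((n + i).factorial : ℚ))),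
    Fin.prod_univ_eq_prod_range (fun j => ((2 * n + (A - j)).factorial : ℚ))]
  have h1 := Finset.prod_range_reflect (fun j => ((2 * n + j).factorial : ℚ)) (A + 1)
  have h2 := Finset.prod_range_reflect (fun j => ((n + j).factorial : ℚ)) (A + 1)
  simp only [Nat.add_sub_cancel_right] at h1 h2
  rw [h1, Finset.prod_div_distrib, Finset.prod_div_distrib, Finset.prod_mul_distrib,
    Finset.prod_mul_distrib, h2, Finset.prod_pow]
  have h3 : ∏ k ∈ Finset.range (A + 1), ((n + k).factorial : ℚ) ≠ 0 :=
    Finset.prod_ne_zero_iff.2 fun k _ => by positivity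
  simp
  field_simp

lemma prod_box_layer (n k : ℕ) :
    ∏ i ∈ Finset.Icc 1 n, ∏ j ∈ Finset.Icc 1 n,
        (((i : ℚ) + j + (k + 1 : ℕ) - 1) / (i + j + (k + 1 : ℕ) - 2)) =
      ((2 * n + k).factorial : ℚ) * (k.factorial : ℚ) / ((n + k).factorial : ℚ) ^ 2 := by
  have hrow (i b : ℕ) (hi : 1 ≤ i) : ∏ j ∈ Finset.Icc 1 b,
      (((i : ℚ) + j + (k + 1 : ℕ) - 1) / (i + j + (k + 1 : ℕ) - 2)) = (i + b + k) / (i + k) := by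
    have hik : (i : ℚ) + k ≠ 0 := by positivity
    induction b with
    | zero => simp [hik]
    | succ b ih =>
      have : (i : ℚ) + b + k ≠ 0 := by positivity
      rw [Finset.prod_Icc_succ_top (by omega), ih]
      push_cast
      rw [show (i : ℚ) + (b + 1) + (k + 1) - 2 = i + b + k by ring]
      field_simp
      ring
  have hcol (b : ℕ) : ∏ i ∈ Finset.Icc 1 b, (((i : ℚ) + n + k) / (i + k)) =
      ((b + n + k).factorial : ℚ) * (k.factorial : ℚ) /
        (((n + k).factorial : ℚ) * ((b + k).factorial : ℚ)) := by
    induction b with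
    | zero =>
      simp [mul_comm, div_self, Nat.factorial_ne_zero]
    | succ b ih =>
      rw [Finset.prod_Icc_succ_top (by omega), ih, show b + 1 + n + k = b + n + k + 1 by ring,
        show b + 1 + k = b + k + 1 by ring, Nat.factorial_succ, Nat.factorial_succ]
      push_cast
      field_simp
      ring
  rw [Finset.prod_congr rfl fun i hi => hrow i n (Finset.mem_Icc.1 hi).1, hcol, two_mul]
  ring

lemma det_toeplitz_eq_prod_box (n A : ℕ) :
    (Matrix.of fun i j : Fin (A + 1) => chooseInt (2 * n) (n + j - i)).det =
      ∏ i ∈ Finset.Icc 1 n, ∏ j ∈ Finset.Icc 1 n, ∏ k ∈ Finset.Icc 1 (A + 1),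
        (((i : ℚ) + j + k - 1) / (i + j + k - 2)) := by
  simp_rw [Finset.prod_comm (t := Finset.Icc 1 (A + 1))]
  rw [det_toeplitz, ← Finset.Ico_add_one_right_eq_Icc 1 (A + 1), ← zero_add 1,
    ← Finset.prod_Ico_add', ← Finset.range_eq_Ico]
  refine Finset.prod_congr (by simp) fun k _ => ?_
  rw [zero_add, ← prod_box_layer]

end MacMahon

section PathCounting

/-- The weighted number of single paths from `j` to `x` in `k` steps, each step being `0` or `-1`,
that do not visit `x₀` at time `h`. -/
def pathKernel (h : ℕ) (x₀ : ℤ) : ℕ → ℤ → ℤ → ℚ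
  | 0, x, j => if x = j then 1 else 0
  | k + 1, x, j => if k + 1 = h ∧ x = x₀ then 0 else
      pathKernel h x₀ k x j + pathKernel h x₀ k (x + 1) j

/-- Families of nonintersecting paths with `k` steps, each step being `0` or `-1`, that start at
`0, 1, …, a - 1`, end at `z`, and avoid `x₀` at time `h`. They are continued by constants. -/
def pathFamilies (a h : ℕ) (x₀ : ℤ) (k : ℕ) (z : Fin a → ℤ) : Set (ℕ → Fin a → ℤ) :=
  {y | (∀ r, y 0 r = r) ∧ (∀ j < k, ∀ r, y j r = y (j + 1) r ∨ y j r = y (j + 1) r + 1) ∧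
    (∀ j ≤ k, StrictMono (y j)) ∧ (∀ j, k ≤ j → y j = z) ∧ (h ≤ k → ∀ r, y h r ≠ x₀)}

variable {a h : ℕ} {x₀ : ℤ}

lemma pathFamilies_eq_empty_of_not_strictMono {k : ℕ} {z : Fin a → ℤ} (hz : ¬ StrictMono z) :
    pathFamilies a h x₀ k z = ∅ := by
  refine Set.eq_empty_of_forall_notMem fun y hy => hz ?_
  rw [← hy.2.2.2.1 k le_rfl]
  exact hy.2.2.1 k le_rfl

lemma pathFamilies_eq_empty_of_mem {z : Fin a → ℤ} {r : Fin a} (hr : z r = x₀) :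
    pathFamilies a h x₀ h z = ∅ := by
  refine Set.eq_empty_of_forall_notMem fun y hy => hy.2.2.2.2 le_rfl r ?_
  rw [hy.2.2.2.1 h le_rfl, hr]

/-- Prolonging a family of paths by one step. -/
def extendPath (k : ℕ) (z : Fin a → ℤ) (y : ℕ → Fin a → ℤ) : ℕ → Fin a → ℤ :=
  fun j => if j ≤ k then y j else z

lemma extendPath_of_le {k j : ℕ} (hj : j ≤ k) (z : Fin a → ℤ) (y : ℕ → Fin a → ℤ) :
    extendPath k z y j = y j := if_pos hj

lemma extendPath_of_lt {k j : ℕ} (hj : k < j) (z : Fin a → ℤ) (y : ℕ → Fin a → ℤ) :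
    extendPath k z y j = z := if_neg (not_le.2 hj)

lemma extendPath_mem {k : ℕ} {z : Fin a → ℤ} (hz : StrictMono z)
    (hx : k + 1 = h → ∀ r, z r ≠ x₀) {e : Fin a → Fin 2} {y : ℕ → Fin a → ℤ}
    (hy : y ∈ pathFamilies a h x₀ k fun r => z r + (e r : ℕ)) :
    extendPath k z y ∈ pathFamilies a h x₀ (k + 1) z := by
  obtain ⟨h0, h1, h2, h3, h4⟩ := hy
  refine ⟨?_, fun j hj r => ?_, fun j hj => ?_, fun j hj => extendPath_of_lt hj z y, fun hk => ?_⟩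
  · rwa [extendPath_of_le (Nat.zero_le k)]
  · rcases (Nat.lt_succ_iff_lt_or_eq.1 hj) with hj | rfl
    · rw [extendPath_of_le hj.le, extendPath_of_le (Nat.succ_le_of_lt hj)]
      exact h1 j hj r
    · rw [extendPath_of_le le_rfl, extendPath_of_lt (Nat.lt_succ_self j), h3 j le_rfl]
      have := (e r).isLt
      change z r + ((e r : ℕ) : ℤ) = z r ∨ z r + ((e r : ℕ) : ℤ) = z r + 1
      omega
  · rcases hj.lt_or_eq with hj | rfl
    · rw [extendPath_of_le (by omega)]
      exact h2 j (by omega)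
    · rwa [extendPath_of_lt (Nat.lt_succ_self k)]
  · rcases hk.lt_or_eq with hk | rfl
    · rw [extendPath_of_le (by omega)]
      exact h4 (by omega)
    · rw [extendPath_of_lt (Nat.lt_succ_self k)]
      exact hx rfl

lemma exists_extendPath_eq {k : ℕ} {z : Fin a → ℤ} {y : ℕ → Fin a → ℤ}
    (hy : y ∈ pathFamilies a h x₀ (k + 1) z) :
    ∃ e : Fin a → Fin 2, ∃ y' ∈ pathFamilies a h x₀ k fun r => z r + (e r : ℕ),
      extendPath k z y' = y := by
  obtain ⟨h0, h1, h2, h3, h4⟩ := hy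
  have hk : y (k + 1) = z := h3 _ le_rfl
  have hmin {j : ℕ} (hj : j ≤ k) : min j k = j := min_eq_left hj
  refine ⟨fun r => if y k r = z r then 0 else 1, fun j => y (min j k), ⟨?_, ?_, ?_, ?_, ?_⟩, ?_⟩
  · simpa using h0
  · intro j hj
    beta_reduce
    rw [hmin hj.le, hmin (Nat.succ_le_of_lt hj)]
    exact h1 j (by omega)
  · intro j hj
    beta_reduce
    rw [hmin hj]
    exact h2 j (by omega)
  · intro j hj
    ext r
    beta_reduce
    rw [min_eq_right hj]
    have := h1 k (Nat.lt_succ_self k) r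
    rw [hk] at this
    split_ifs with hr
    · simp [hr]
    · simpa [hr] using this
  · intro hk
    beta_reduce
    rw [hmin hk]
    exact h4 (by omega)
  · ext j r
    rcases le_or_gt j k with hj | hj
    · rw [extendPath_of_le hj, hmin hj]
    · rw [extendPath_of_lt hj, h3 j hj]

lemma extendPath_bijective {k : ℕ} {z : Fin a → ℤ} (hz : StrictMono z)
    (hx : k + 1 = h → ∀ r, z r ≠ x₀) :
    Function.Bijective (fun w : (e : Fin a → Fin 2) ×
        pathFamilies a h x₀ k (fun r => z r + (e r : ℕ)) =>
      (⟨extendPath k z w.2.1, extendPath_mem hz hx w.2.2⟩ : pathFamilies a h x₀ (k + 1) z)) := by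
  refine ⟨?_, fun ⟨y, hy⟩ => ?_⟩
  · rintro ⟨e, y, hy⟩ ⟨e', y', hy'⟩ heq
    have hext (j : ℕ) : extendPath k z y j = extendPath k z y' j :=
      congrFun (congrArg Subtype.val heq) j
    have hle {j : ℕ} (hj : j ≤ k) : y j = y' j := by
      simpa only [extendPath_of_le hj] using hext j
    have hee : e = e' := by
      have h1 := hle le_rfl
      rw [hy.2.2.2.1 k le_rfl, hy'.2.2.2.1 k le_rfl] at h1
      ext r
      simpa using congrFun h1 r
    subst hee
    have hyy : y = y' := by
      ext1 j
      rcases le_total j k with hj | hj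
      · exact hle hj
      · rw [hy.2.2.2.1 j hj, hy'.2.2.2.1 j hj]
    subst hyy
    rfl
  · obtain ⟨e, y', hy', rfl⟩ := exists_extendPath_eq hy
    exact ⟨⟨e, y', hy'⟩, rfl⟩

lemma pathFamilies_zero (hh : 0 < h) (z : Fin a → ℤ) :
    pathFamilies a h x₀ 0 z = {y | y = (fun _ => z) ∧ z = fun r : Fin a => (r : ℤ)} := by
  ext y
  constructor
  · rintro ⟨h0, -, -, h3, -⟩
    refine ⟨funext fun j => h3 j (Nat.zero_le j), ?_⟩
    rw [← h3 0 le_rfl]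
    exact funext h0
  · rintro ⟨rfl, rfl⟩
    refine ⟨fun r => rfl, fun j hj => absurd hj (Nat.not_lt_zero j), fun j _ r r' hr => ?_,
      fun j _ => rfl, fun hk => absurd hk (by omega)⟩
    exact Int.ofNat_lt.2 hr

lemma finite_pathFamilies (hh : 0 < h) (k : ℕ) (z : Fin a → ℤ) :
    Finite (pathFamilies a h x₀ k z) := by
  induction k generalizing z with
  | zero =>
    rw [pathFamilies_zero hh]
    exact (Set.finite_singleton fun _ => z).subset fun y hy => hy.1
  | succ k ih =>
    by_cases hz : StrictMono z
    · by_cases hx : k + 1 = h → ∀ r, z r ≠ x₀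
      · exact Finite.of_surjective _ (extendPath_bijective hz hx).2
      · push Not at hx
        obtain ⟨rfl, r, hr⟩ := hx
        rw [pathFamilies_eq_empty_of_mem hr]
        exact Set.finite_empty
    · rw [pathFamilies_eq_empty_of_not_strictMono hz]
      exact Set.finite_empty

lemma exists_notMem_of_strictMono_ne {z : Fin a → ℤ} (hz : StrictMono z)
    (hne : z ≠ fun r : Fin a => (r : ℤ)) : ∃ r, ∀ j : Fin a, z r ≠ j := by
  by_contra! hcon
  choose f hf using hcon
  have hmono : StrictMono f := fun i j hij => by
    have := hz hij
    rw [hf, hf] at this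
    exact_mod_cast this
  exact hne (funext fun r => by
    rw [hf, le_antisymm (hmono.apply_le (x := r)) (hmono.le_apply (x := r))])

/-- The Lindström–Gessel–Viennot determinant for the families in `pathFamilies`. -/
lemma card_pathFamilies (hh : 0 < h) (k : ℕ) {z : Fin a → ℤ} (hz : StrictMono z) :
    (Nat.card (pathFamilies a h x₀ k z) : ℚ) =
      (Matrix.of fun i j : Fin a => pathKernel h x₀ k (z i) j).det := by
  induction k generalizing z with
  | zero =>
    rw [pathFamilies_zero hh]
    by_cases hid : z = fun r : Fin a => (r : ℤ)
    · subst hid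
      have h1 : (Matrix.of fun i j : Fin a => pathKernel h x₀ 0 (i : ℤ) j) = 1 := by
        ext i j
        simp [pathKernel, Matrix.one_apply, Fin.ext_iff]
      rw [h1, Matrix.det_one]
      simp
    · obtain ⟨r, hr⟩ := exists_notMem_of_strictMono_ne hz hid
      rw [Matrix.det_eq_zero_of_row_eq_zero r fun j => by simp [pathKernel, hr j]]
      simp [hid]
  | succ k ih =>
    by_cases hx : k + 1 = h → ∀ r, z r ≠ x₀
    · have hfin (e : Fin a → Fin 2) := finite_pathFamilies (x₀ := x₀) hh k
        (fun r => z r + (e r : ℕ))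
      have hterm (e : Fin a → Fin 2) :
          (Nat.card (pathFamilies a h x₀ k fun r => z r + (e r : ℕ)) : ℚ) =
          (Matrix.of fun i j : Fin a => pathKernel h x₀ k (z i + (e i : ℕ)) j).det := by
        by_cases hze : StrictMono fun r => z r + ((e r : ℕ) : ℤ)
        · exact ih hze
        · rw [pathFamilies_eq_empty_of_not_strictMono hze]
          simp only [StrictMono, not_forall] at hze
          obtain ⟨i, i', hi, hnot⟩ := hze
          have hlt := hz hi
          have := (e i).isLt
          have heq : z i + ((e i : ℕ) : ℤ) = z i' + ((e i' : ℕ) : ℤ) := by omega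
          rw [Matrix.det_zero_of_row_eq hi.ne (by ext j; simp [heq])]
          simp
      rw [← Nat.card_congr (Equiv.ofBijective _ (extendPath_bijective hz hx)), Nat.card_sigma,
        Nat.cast_sum, Finset.sum_congr rfl fun e _ => hterm e]
      have hsum := (Matrix.detRowAlternating (n := Fin a) (R := ℚ)).toMultilinearMap.map_sum
        (fun i (b : Fin 2) (j : Fin a) => pathKernel h x₀ k (z i + (b : ℕ)) j)
      refine hsum.symm.trans (congrArg Matrix.det ?_)
      ext i j
      have hcond : ¬ (k + 1 = h ∧ z i = x₀) := fun hc => hx hc.1 i hc.2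
      simp [pathKernel, hcond]
    · push Not at hx
      obtain ⟨rfl, r, hr⟩ := hx
      rw [pathFamilies_eq_empty_of_mem hr,
        Matrix.det_eq_zero_of_row_eq_zero r fun j => by simp [pathKernel, hr]]
      simp

lemma pathKernel_eq (hh : 0 < h) (k : ℕ) (x j : ℤ) :
    pathKernel h x₀ k x j = chooseInt k (j - x) -
      if h ≤ k then chooseInt h (j - x₀) * chooseInt (k - h) (x₀ - x) else 0 := by
  induction k generalizing x with
  | zero => simp [pathKernel, chooseInt_zero, show ¬ h ≤ 0 by omega, sub_eq_zero, eq_comm]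
  | succ k ih =>
    rw [pathKernel, ih, ih, chooseInt_succ, show j - (x + 1) = j - x - 1 by ring,
      show x₀ - (x + 1) = x₀ - x - 1 by ring]
    rcases lt_trichotomy (k + 1) h with hk | rfl | hk
    · simp [show ¬ k + 1 = h by omega, show ¬ h ≤ k by omega, show ¬ h ≤ k + 1 by omega]
    · by_cases hx : x = x₀
      · subst hx
        simp [chooseInt_zero, chooseInt_succ]
      · simp [chooseInt_zero, hx, sub_eq_zero, Ne.symm hx]
    · rw [if_neg (by omega), if_pos (by omega), if_pos (by omega),
        show k + 1 - h = k - h + 1 by omega, chooseInt_succ (k - h), if_pos (by omega)]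
      ring

end PathCounting

section TilingsAsPaths

/-- Exactly one of three propositions holds. -/
def ExactlyOne (p q r : Prop) : Prop := (p ∨ q ∨ r) ∧ ¬ (p ∧ q) ∧ ¬ (p ∧ r) ∧ ¬ (q ∧ r)

lemma existsUnique_mem_triple {α : Type*} {T : Set α} {t₀ t₁ t₂ : α} (h₀₁ : t₀ ≠ t₁)
    (h₀₂ : t₀ ≠ t₂) (h₁₂ : t₁ ≠ t₂) :
    (∃! t, t ∈ T ∧ (t = t₀ ∨ t = t₁ ∨ t = t₂)) ↔ ExactlyOne (t₀ ∈ T) (t₁ ∈ T) (t₂ ∈ T) := by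
  constructor
  · rintro ⟨t, ⟨ht, h⟩, huniq⟩
    have h0 (h : t₀ ∈ T) : t₀ = t := huniq t₀ ⟨h, .inl rfl⟩
    have h1 (h : t₁ ∈ T) : t₁ = t := huniq t₁ ⟨h, .inr (.inl rfl)⟩
    have h2 (h : t₂ ∈ T) : t₂ = t := huniq t₂ ⟨h, .inr (.inr rfl)⟩
    refine ⟨?_, fun h => h₀₁ ((h0 h.1).trans (h1 h.2).symm),
      fun h => h₀₂ ((h0 h.1).trans (h2 h.2).symm), fun h => h₁₂ ((h1 h.1).trans (h2 h.2).symm)⟩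
    rcases h with rfl | rfl | rfl <;> simp [ht]
  · rintro ⟨h | h | h, h01, h02, h12⟩
    · refine ⟨t₀, ⟨h, .inl rfl⟩, ?_⟩
      rintro t ⟨ht, rfl | rfl | rfl⟩ <;> tauto
    · refine ⟨t₁, ⟨h, .inr (.inl rfl)⟩, ?_⟩
      rintro t ⟨ht, rfl | rfl | rfl⟩ <;> tauto
    · refine ⟨t₂, ⟨h, .inr (.inr rfl)⟩, ?_⟩
      rintro t ⟨ht, rfl | rfl | rfl⟩ <;> tauto

lemma inHexagon_up {a n : ℕ} {i j : ℤ} : inHexagon a n n (i, j, false) ↔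
    -(n : ℤ) ≤ i ∧ i ≤ a - 1 ∧ 0 ≤ j ∧ j ≤ n + n - 1 ∧ 0 ≤ i + j ∧ i + j ≤ a + n - 1 := by
  simp [inHexagon]

lemma inHexagon_down {a n : ℕ} {i j : ℤ} : inHexagon a n n (i, j, true) ↔
    -(n : ℤ) ≤ i ∧ i ≤ a - 1 ∧ 0 ≤ j ∧ j ≤ n + n - 1 ∧ -1 ≤ i + j ∧ i + j ≤ a + n - 2 := by
  simp [inHexagon]

lemma covers_zero_iff {i j : ℤ} {x : Triangle} :
    covers (i, j, 0) x ↔ x = (i, j, false) ∨ x = (i, j, true) := by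
  simp [covers]

lemma covers_one_iff {i j : ℤ} {x : Triangle} :
    covers (i, j, 1) x ↔ x = (i, j, false) ∨ x = (i - 1, j, true) := by
  simp [covers]

lemma covers_two_iff {i j : ℤ} {x : Triangle} :
    covers (i, j, 2) x ↔ x = (i, j, false) ∨ x = (i, j - 1, true) := by
  simp [covers]

lemma covers_up_iff {t : Tile} {i j : ℤ} :
    covers t (i, j, false) ↔ t = (i, j, 0) ∨ t = (i, j, 1) ∨ t = (i, j, 2) := by
  obtain ⟨i', j', d⟩ := t
  fin_cases d
  · simp [covers_zero_iff, eq_comm]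
  · simp [covers_one_iff, eq_comm]
  · simp [covers_two_iff, eq_comm]

lemma covers_down_iff {t : Tile} {i j : ℤ} :
    covers t (i, j, true) ↔ t = (i, j, 0) ∨ t = (i + 1, j, 1) ∨ t = (i, j + 1, 2) := by
  obtain ⟨i', j', d⟩ := t
  fin_cases d
  · simp [covers_zero_iff, eq_comm]
  · simp [covers_one_iff, eq_comm]
    omega
  · simp [covers_two_iff, eq_comm]
    omega

lemma isTiling_iff {a n : ℕ} {T : Set Tile} : IsTiling a n n T ↔
    ((∀ i j, (i, j, 0) ∈ T →
        inHexagon a n n (i, j, false) ∧ inHexagon a n n (i, j, true)) ∧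
      (∀ i j, (i, j, 1) ∈ T →
        inHexagon a n n (i, j, false) ∧ inHexagon a n n (i - 1, j, true)) ∧
      (∀ i j, (i, j, 2) ∈ T →
        inHexagon a n n (i, j, false) ∧ inHexagon a n n (i, j - 1, true))) ∧
    (∀ i j, inHexagon a n n (i, j, false) →
      ExactlyOne ((i, j, 0) ∈ T) ((i, j, 1) ∈ T) ((i, j, 2) ∈ T)) ∧
    (∀ i j, inHexagon a n n (i, j, true) →
      ExactlyOne ((i, j, 0) ∈ T) ((i + 1, j, 1) ∈ T) ((i, j + 1, 2) ∈ T)) := by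
  have hup (i j : ℤ) : (∃! t, t ∈ T ∧ covers t (i, j, false)) ↔
      ExactlyOne ((i, j, 0) ∈ T) ((i, j, 1) ∈ T) ((i, j, 2) ∈ T) := by
    simp_rw [covers_up_iff]
    exact existsUnique_mem_triple (by simp) (by simp) (by simp)
  have hdown (i j : ℤ) : (∃! t, t ∈ T ∧ covers t (i, j, true)) ↔
      ExactlyOne ((i, j, 0) ∈ T) ((i + 1, j, 1) ∈ T) ((i, j + 1, 2) ∈ T) := by
    simp_rw [covers_down_iff]
    exact existsUnique_mem_triple (by simp) (by simp) (by simp)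
  simp_rw [← hup, ← hdown]
  constructor
  · rintro ⟨hin, hcov⟩
    refine ⟨⟨fun i j h => ⟨?_, ?_⟩, fun i j h => ⟨?_, ?_⟩, fun i j h => ⟨?_, ?_⟩⟩,
      fun i j => hcov (i, j, false), fun i j => hcov (i, j, true)⟩
    all_goals exact hin _ h _ (by simp [covers_zero_iff, covers_one_iff, covers_two_iff])
  · rintro ⟨⟨h0, h1, h2⟩, hu, hd⟩
    refine ⟨?_, ?_⟩
    · rintro ⟨i, j, d⟩ ht x hx
      fin_cases d
      · rcases covers_zero_iff.1 hx with rfl | rfl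
        exacts [(h0 i j ht).1, (h0 i j ht).2]
      · rcases covers_one_iff.1 hx with rfl | rfl
        exacts [(h1 i j ht).1, (h1 i j ht).2]
      · rcases covers_two_iff.1 hx with rfl | rfl
        exacts [(h2 i j ht).1, (h2 i j ht).2]
    · rintro ⟨i, j, _ | _⟩ hx
      exacts [hu i j hx, hd i j hx]

/-- The tiles determined by a family of nonintersecting paths. -/
def tilesOfPaths (a n : ℕ) (y : ℕ → Fin a → ℤ) : Set Tile :=
  {t | ∃ j : ℕ, j < 2 * n ∧ t.2.1 = j ∧
    ((t.2.2 = 0 ∧ ∃ r, y j r = t.1 ∧ y (j + 1) r = t.1) ∨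
      (t.2.2 = 1 ∧ ∃ r, y j r = t.1 ∧ y (j + 1) r = t.1 - 1) ∨
      (t.2.2 = 2 ∧ inHexagon a n n (t.1, t.2.1, false) ∧ ∀ r, y j r ≠ t.1))}

variable {a n h : ℕ} {x₀ : ℤ} {y : ℕ → Fin a → ℤ}

lemma mem_tilesOfPaths_zero {i : ℤ} {j : ℕ} (hj : j < 2 * n) :
    ((i, (j : ℤ), 0) : Tile) ∈ tilesOfPaths a n y ↔ ∃ r, y j r = i ∧ y (j + 1) r = i := by
  constructor
  · rintro ⟨j', -, hjj, h⟩
    obtain rfl : j = j' := Int.ofNat_inj.1 hjj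
    simpa using h
  · exact fun hr => ⟨j, hj, rfl, .inl ⟨rfl, hr⟩⟩

lemma mem_tilesOfPaths_one {i : ℤ} {j : ℕ} (hj : j < 2 * n) :
    ((i, (j : ℤ), 1) : Tile) ∈ tilesOfPaths a n y ↔ ∃ r, y j r = i ∧ y (j + 1) r = i - 1 := by
  constructor
  · rintro ⟨j', -, hjj, h⟩
    obtain rfl : j = j' := Int.ofNat_inj.1 hjj
    simpa using h
  · exact fun hr => ⟨j, hj, rfl, .inr (.inl ⟨rfl, hr⟩)⟩

lemma mem_tilesOfPaths_two {i : ℤ} {j : ℕ} (hj : j < 2 * n) :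
    ((i, (j : ℤ), 2) : Tile) ∈ tilesOfPaths a n y ↔
      inHexagon a n n (i, j, false) ∧ ∀ r, y j r ≠ i := by
  constructor
  · rintro ⟨j', -, hjj, h⟩
    obtain rfl : j = j' := Int.ofNat_inj.1 hjj
    simpa using h
  · exact fun hr => ⟨j, hj, rfl, .inr (.inr ⟨rfl, hr⟩)⟩

lemma exists_eq_natCast_of_mem_tilesOfPaths {t : Tile} (ht : t ∈ tilesOfPaths a n y) :
    ∃ j : ℕ, j < 2 * n ∧ t.2.1 = j := by
  obtain ⟨j, hj, hjt, -⟩ := ht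
  exact ⟨j, hj, hjt⟩

section Family

variable (hy : y ∈ pathFamilies a h x₀ (2 * n) fun r => (r : ℤ) - n)
include hy

lemma pathFamilies_step {j : ℕ} (hj : j < 2 * n) (r : Fin a) :
    y j r = y (j + 1) r ∨ y j r = y (j + 1) r + 1 := hy.2.1 j hj r

lemma pathFamilies_injective {j : ℕ} (hj : j ≤ 2 * n) : Function.Injective (y j) :=
  (hy.2.2.1 j hj).injective

lemma pathFamilies_le_start {j : ℕ} (hj : j ≤ 2 * n) (r : Fin a) :
    y j r ≤ r ∧ (r : ℤ) ≤ y j r + j := by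
  induction j with
  | zero => simp [hy.1]
  | succ j ih =>
    have := ih (by omega)
    have := pathFamilies_step hy hj r
    push_cast
    omega

lemma pathFamilies_le_end {j : ℕ} (hj : j ≤ 2 * n) (r : Fin a) :
    (r : ℤ) - n ≤ y (2 * n - j) r ∧ y (2 * n - j) r ≤ r - n + j := by
  induction j with
  | zero => simp [hy.2.2.2.1 (2 * n) le_rfl]
  | succ j ih =>
    have := ih (by omega)
    have hstep := pathFamilies_step hy (show 2 * n - (j + 1) < 2 * n by omega) r
    rw [show 2 * n - (j + 1) + 1 = 2 * n - j by omega] at hstep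
    push_cast
    omega

lemma pathFamilies_bounds {j : ℕ} (hj : j ≤ 2 * n) (r : Fin a) :
    -(n : ℤ) ≤ y j r ∧ y j r ≤ a - 1 ∧ 0 ≤ y j r + j ∧ y j r + j ≤ a + n - 1 := by
  have h1 := pathFamilies_le_start hy hj r
  have h2 := pathFamilies_le_end hy (show 2 * n - j ≤ 2 * n by omega) r
  rw [show 2 * n - (2 * n - j) = j by omega] at h2
  have := r.isLt
  omega

lemma inHexagon_up_path {j : ℕ} (hj : j < 2 * n) (r : Fin a) :
    inHexagon a n n (y j r, j, false) := by
  have := pathFamilies_bounds hy hj.le r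
  rw [inHexagon_up]
  omega

lemma inHexagon_down_path {j : ℕ} (hj : j < 2 * n) (r : Fin a) :
    inHexagon a n n (y (j + 1) r, j, true) := by
  have := pathFamilies_bounds hy (show j + 1 ≤ 2 * n from hj) r
  rw [inHexagon_down]
  push_cast at this
  omega

lemma exists_path_zero_eq {i : ℤ} (hi : 0 ≤ i) (hia : i ≤ a - 1) : ∃ r, y 0 r = i := by
  lift i to ℕ using hi
  exact ⟨⟨i, by omega⟩, hy.1 _⟩

lemma exists_path_top_eq {i : ℤ} (hi : -(n : ℤ) ≤ i) (hia : i + n ≤ a - 1) :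
    ∃ r, y (2 * n) r = i := by
  obtain ⟨k, hk⟩ := Int.eq_ofNat_of_zero_le (show 0 ≤ i + n by omega)
  refine ⟨⟨k, by omega⟩, ?_⟩
  rw [hy.2.2.2.1 (2 * n) le_rfl]
  simp only
  omega

lemma isTiling_tilesOfPaths : IsTiling a n n (tilesOfPaths a n y) := by
  refine isTiling_iff.2 ⟨⟨fun i j ht => ?_, fun i j ht => ?_, fun i j ht => ?_⟩,
    fun i j hin => ?_, fun i j hin => ?_⟩
  · obtain ⟨j, hj, rfl⟩ := exists_eq_natCast_of_mem_tilesOfPaths ht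
    obtain ⟨r, hr, hr'⟩ := (mem_tilesOfPaths_zero hj).1 ht
    exact ⟨hr ▸ inHexagon_up_path hy hj r, hr' ▸ inHexagon_down_path hy hj r⟩
  · obtain ⟨j, hj, rfl⟩ := exists_eq_natCast_of_mem_tilesOfPaths ht
    obtain ⟨r, hr, hr'⟩ := (mem_tilesOfPaths_one hj).1 ht
    exact ⟨hr ▸ inHexagon_up_path hy hj r, hr' ▸ inHexagon_down_path hy hj r⟩
  · obtain ⟨j, hj, rfl⟩ := exists_eq_natCast_of_mem_tilesOfPaths ht
    obtain ⟨hin, hne⟩ := (mem_tilesOfPaths_two hj).1 ht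
    refine ⟨hin, ?_⟩
    rw [inHexagon_up] at hin
    rw [inHexagon_down]
    rcases j with _ | j
    · obtain ⟨r, hr⟩ := exists_path_zero_eq hy (i := i) (by simpa using hin.2.2.2.2.1) hin.2.1
      exact absurd hr (hne r)
    · push_cast at hin ⊢
      omega
  · obtain ⟨j, rfl⟩ := Int.eq_ofNat_of_zero_le (inHexagon_up.1 hin).2.2.1
    have hj : j < 2 * n := by
      have := (inHexagon_up.1 hin).2.2.2.1
      omega
    rw [mem_tilesOfPaths_zero hj, mem_tilesOfPaths_one hj, mem_tilesOfPaths_two hj]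
    refine ⟨?_, ?_, ?_, ?_⟩
    · by_cases hr : ∃ r, y j r = i
      · obtain ⟨r, rfl⟩ := hr
        rcases pathFamilies_step hy hj r with hs | hs
        · exact .inl ⟨r, rfl, hs.symm⟩
        · exact .inr (.inl ⟨r, rfl, by omega⟩)
      · push Not at hr
        exact .inr (.inr ⟨hin, hr⟩)
    · rintro ⟨⟨r, hr, hs⟩, ⟨r', hr', hs'⟩⟩
      obtain rfl := pathFamilies_injective hy hj.le (hr.trans hr'.symm)
      omega
    · rintro ⟨⟨r, hr, -⟩, -, hne⟩
      exact hne r hr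
    · rintro ⟨⟨r, hr, -⟩, -, hne⟩
      exact hne r hr
  · obtain ⟨j, rfl⟩ := Int.eq_ofNat_of_zero_le (inHexagon_down.1 hin).2.2.1
    have hin' := inHexagon_down.1 hin
    have hj : j < 2 * n := by omega
    have hnot (hr : ∃ r, y (j + 1) r = i) :
        ((i, ((j : ℕ) : ℤ) + 1, 2) : Tile) ∉ tilesOfPaths a n y := by
      intro ht
      obtain ⟨j', hj', hjj⟩ := exists_eq_natCast_of_mem_tilesOfPaths ht
      obtain rfl : j' = j + 1 := by
        simp only at hjj
        omega
      rw [← Nat.cast_succ, mem_tilesOfPaths_two hj'] at ht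
      exact ht.2 _ hr.choose_spec
    rw [mem_tilesOfPaths_zero hj, mem_tilesOfPaths_one hj, add_sub_cancel_right]
    refine ⟨?_, ?_, ?_, ?_⟩
    · by_cases hr : ∃ r, y (j + 1) r = i
      · obtain ⟨r, rfl⟩ := hr
        rcases pathFamilies_step hy hj r with hs | hs
        · exact .inl ⟨r, hs, rfl⟩
        · exact .inr (.inl ⟨r, hs, rfl⟩)
      · have hj' : j + 1 < 2 * n := by
          refine lt_of_le_of_ne hj fun hjn => hr ?_
          rw [hjn]
          exact exists_path_top_eq hy hin'.1 (by omega)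
        rw [← Nat.cast_succ, mem_tilesOfPaths_two hj', inHexagon_up]
        push Not at hr
        refine .inr (.inr ⟨?_, hr⟩)
        push_cast
        omega
    · rintro ⟨⟨r, hr, hs⟩, ⟨r', hr', hs'⟩⟩
      obtain rfl := pathFamilies_injective hy hj (hs.trans hs'.symm)
      omega
    · rintro ⟨⟨r, -, hs⟩, ht⟩
      exact hnot ⟨r, hs⟩ ht
    · rintro ⟨⟨r, -, hs⟩, ht⟩
      exact hnot ⟨r, hs⟩ ht

lemma path_eq_of_tilesOfPaths_eq {y' : ℕ → Fin a → ℤ}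
    (hy' : y' ∈ pathFamilies a h x₀ (2 * n) fun r => (r : ℤ) - n)
    (heq : tilesOfPaths a n y = tilesOfPaths a n y') : y = y' := by
  ext1 j
  rcases le_total (2 * n) j with hj | hj
  · rw [hy.2.2.2.1 j hj, hy'.2.2.2.1 j hj]
  · induction j with
    | zero => exact funext fun r => (hy.1 r).trans (hy'.1 r).symm
    | succ j ih =>
      have ih := ih (by omega)
      ext r
      have hkey : y j r = y (j + 1) r ↔ y' j r = y' (j + 1) r := by
        have hmem {w : ℕ → Fin a → ℤ}
            (hw : w ∈ pathFamilies a h x₀ (2 * n) fun r => (r : ℤ) - n) :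
            ((w j r, (j : ℤ), 0) : Tile) ∈ tilesOfPaths a n w ↔ w j r = w (j + 1) r := by
          rw [mem_tilesOfPaths_zero hj]
          constructor
          · rintro ⟨r', h1, h2⟩
            obtain rfl := pathFamilies_injective hw (by omega) h1
            exact h2.symm
          · exact fun hs => ⟨r, rfl, hs.symm⟩
        rw [← hmem hy, ← hmem hy', heq, ih]
      have h1 := pathFamilies_step hy hj r
      have h2 := pathFamilies_step hy' hj r
      have h3 := congrFun ih r
      omega

end Family

open Classical in
/-- The family of nonintersecting paths crossing the tiles of orientations `0` and `1`. -/
noncomputable def pathsOfTiling (a n : ℕ) (T : Set Tile) : ℕ → Fin a → ℤ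
  | 0, r => r
  | j + 1, r => if j < 2 * n ∧ ((pathsOfTiling a n T j r, (j : ℤ), 0) : Tile) ∉ T then
      pathsOfTiling a n T j r - 1 else pathsOfTiling a n T j r

/-- At level `j` the paths occupy exactly the upward triangles that are not covered by a tile of
orientation `2`. -/
def PathsFit (a n : ℕ) (T : Set Tile) (j : ℕ) : Prop :=
  (∀ r, inHexagon a n n (pathsOfTiling a n T j r, j, false)) ∧
    ∀ i, inHexagon a n n (i, j, false) →
      (((i, (j : ℤ), 2) : Tile) ∈ T ↔ ∀ r, pathsOfTiling a n T j r ≠ i)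

section OfTiling

variable {T : Set Tile}

lemma pathsOfTiling_step (j : ℕ) (r : Fin a) :
    pathsOfTiling a n T j r = pathsOfTiling a n T (j + 1) r ∨
      pathsOfTiling a n T j r = pathsOfTiling a n T (j + 1) r + 1 := by
  rw [pathsOfTiling]
  split_ifs
  · right
    ring
  · exact .inl rfl

lemma pathsOfTiling_const {j : ℕ} (hj : 2 * n ≤ j) (r : Fin a) :
    pathsOfTiling a n T j r = pathsOfTiling a n T (2 * n) r := by
  induction j, hj using Nat.le_induction with
  | base => rfl
  | succ j hj ih => rw [pathsOfTiling, if_neg (by omega), ih]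

variable (hT : IsTiling a n n T)
include hT

lemma PathsFit.mem_or_mem {j : ℕ} (hfit : PathsFit a n T j) (hj : j < 2 * n) (r : Fin a) :
    (((pathsOfTiling a n T j r, (j : ℤ), 0) : Tile) ∈ T ∧
        pathsOfTiling a n T (j + 1) r = pathsOfTiling a n T j r) ∨
      (((pathsOfTiling a n T j r, (j : ℤ), 1) : Tile) ∈ T ∧
        pathsOfTiling a n T (j + 1) r = pathsOfTiling a n T j r - 1) := by
  obtain ⟨-, hup, -⟩ := isTiling_iff.1 hT
  have h2 : ((pathsOfTiling a n T j r, (j : ℤ), 2) : Tile) ∉ T := fun ht =>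
    (hfit.2 _ (hfit.1 r)).1 ht r rfl
  have h01 := (hup _ _ (hfit.1 r)).1
  rw [pathsOfTiling]
  by_cases h0 : ((pathsOfTiling a n T j r, (j : ℤ), 0) : Tile) ∈ T
  · exact .inl ⟨h0, if_neg fun h => h.2 h0⟩
  · exact .inr ⟨by tauto, if_pos ⟨hj, h0⟩⟩

lemma PathsFit.inHexagon_down_succ {j : ℕ} (hfit : PathsFit a n T j) (hj : j < 2 * n) (r : Fin a) :
    inHexagon a n n (pathsOfTiling a n T (j + 1) r, j, true) := by
  obtain ⟨⟨h0, h1, -⟩, -⟩ := isTiling_iff.1 hT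
  rcases hfit.mem_or_mem hT hj r with ⟨ht, hs⟩ | ⟨ht, hs⟩
  · rw [hs]
    exact (h0 _ _ ht).2
  · rw [hs]
    exact (h1 _ _ ht).2

lemma PathsFit.strictMono_succ {j : ℕ} (hfit : PathsFit a n T j) (hj : j < 2 * n)
    (hmono : StrictMono (pathsOfTiling a n T j)) : StrictMono (pathsOfTiling a n T (j + 1)) := by
  obtain ⟨-, -, hdown⟩ := isTiling_iff.1 hT
  intro r r' hr
  have hlt := hmono hr
  have hd := (hdown _ _ (hfit.inHexagon_down_succ hT hj r)).2.1
  rcases hfit.mem_or_mem hT hj r with ⟨ht, hs⟩ | ⟨ht, hs⟩ <;>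
    rcases hfit.mem_or_mem hT hj r' with ⟨ht', hs'⟩ | ⟨ht', hs'⟩
  · omega
  · refine lt_of_le_of_ne (by omega) fun heq => hd ⟨?_, ?_⟩
    · rwa [hs]
    · rwa [heq, hs', sub_add_cancel]
  · omega
  · omega

lemma PathsFit.succ {j : ℕ} (hfit : PathsFit a n T j) (hj : j + 1 < 2 * n) :
    PathsFit a n T (j + 1) := by
  obtain ⟨⟨h0, h1, -⟩, hup, hdown⟩ := isTiling_iff.1 hT
  have hj' : j < 2 * n := by omega
  refine ⟨fun r => ?_, fun i hi => ?_⟩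
  · have h := inHexagon_down.1 (hfit.inHexagon_down_succ hT hj' r)
    rw [inHexagon_up]
    push_cast
    omega
  · have hd : inHexagon a n n (i, j, true) := by
      rw [inHexagon_up] at hi
      push_cast at hi
      rw [inHexagon_down]
      omega
    obtain ⟨hcov, -, h02, h12⟩ := hdown _ _ hd
    rw [Nat.cast_succ]
    constructor
    · rintro ht r rfl
      rcases hfit.mem_or_mem hT hj' r with ⟨ht', hs⟩ | ⟨ht', hs⟩
      · exact h02 ⟨by rwa [hs], ht⟩
      · exact h12 ⟨by rwa [hs, sub_add_cancel], ht⟩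
    · intro hne
      have hocc {i' : ℤ} {d : Fin 3} (hd : d = 0 ∨ d = 1) (ht : ((i', (j : ℤ), d) : Tile) ∈ T) :
          ∃ r, pathsOfTiling a n T j r = i' := by
        have hin : inHexagon a n n (i', j, false) := by
          rcases hd with rfl | rfl
          exacts [(h0 _ _ ht).1, (h1 _ _ ht).1]
        have hu := (hup _ _ hin).2
        by_contra! hcon
        have h2 := (hfit.2 _ hin).2 hcon
        rcases hd with rfl | rfl <;> tauto
      rcases hcov with ht | ht | ht
      · obtain ⟨r, rfl⟩ := hocc (.inl rfl) ht
        refine absurd ?_ (hne r)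
        rw [pathsOfTiling, if_neg fun h => h.2 ht]
      · obtain ⟨r, hr⟩ := hocc (.inr rfl) ht
        refine absurd ?_ (hne r)
        have hu := (hup _ _ (h1 _ _ ht).1).2.1
        rw [pathsOfTiling, if_pos ⟨hj', fun h => hu ⟨by rwa [hr] at h, ht⟩⟩, hr,
          add_sub_cancel_right]
      · exact ht

lemma pathsFit {j : ℕ} (hj : j < 2 * n) : PathsFit a n T j := by
  induction j with
  | zero =>
    obtain ⟨⟨-, -, h2⟩, -⟩ := isTiling_iff.1 hT
    refine ⟨fun r => ?_, fun i hi => ⟨fun ht => ?_, fun hne => ?_⟩⟩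
    · have := r.isLt
      rw [inHexagon_up, pathsOfTiling, Nat.cast_zero]
      omega
    · have := inHexagon_down.1 (h2 _ _ ht).2
      omega
    · rw [inHexagon_up] at hi
      obtain ⟨k, hk⟩ := Int.eq_ofNat_of_zero_le (show 0 ≤ i by simpa using hi.2.2.2.2.1)
      exact absurd hk.symm (hne ⟨k, by omega⟩)
  | succ j ih => exact (ih (by omega)).succ hT hj

lemma strictMono_pathsOfTiling {j : ℕ} (hj : j ≤ 2 * n) :
    StrictMono (pathsOfTiling a n T j) := by
  induction j with
  | zero => exact fun r r' hr => Int.ofNat_lt.2 hr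
  | succ j ih => exact (pathsFit hT hj).strictMono_succ hT hj (ih (by omega))

lemma pathsOfTiling_top (r : Fin a) : pathsOfTiling a n T (2 * n) r = r - n := by
  rcases Nat.eq_zero_or_pos n with rfl | hn
  · simp [pathsOfTiling]
  · by_contra hcon
    obtain ⟨r, hr⟩ := exists_notMem_of_strictMono_ne
      (z := fun r => pathsOfTiling a n T (2 * n) r + n)
      (fun r r' hr => by simpa using strictMono_pathsOfTiling hT le_rfl hr)
      (fun h => hcon (by linarith [congrFun h r]))
    have hlt : 2 * n - 1 < 2 * n := by omega
    have hin := inHexagon_down.1 ((pathsFit hT hlt).inHexagon_down_succ hT hlt r)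
    rw [Nat.sub_add_cancel (by omega)] at hin
    obtain ⟨k, hk⟩ := Int.eq_ofNat_of_zero_le
      (show 0 ≤ pathsOfTiling a n T (2 * n) r + n by omega)
    exact hr ⟨k, by omega⟩ hk

lemma pathsOfTiling_mem (hh : h < 2 * n) (hx : ((x₀, (h : ℤ), 2) : Tile) ∈ T) :
    pathsOfTiling a n T ∈ pathFamilies a h x₀ (2 * n) fun r => (r : ℤ) - n := by
  refine ⟨fun r => by rw [pathsOfTiling], fun j _ r => pathsOfTiling_step j r,
    fun j hj => strictMono_pathsOfTiling hT hj, fun j hj => funext fun r => ?_, fun _ => ?_⟩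
  · rw [pathsOfTiling_const hj, pathsOfTiling_top hT]
  · exact ((pathsFit hT hh).2 _ ((isTiling_iff.1 hT).1.2.2 _ _ hx).1).1 hx

lemma tilesOfPaths_pathsOfTiling : tilesOfPaths a n (pathsOfTiling a n T) = T := by
  obtain ⟨⟨h0, h1, h2⟩, hup, -⟩ := isTiling_iff.1 hT
  have hlevel {i j : ℤ} (hin : inHexagon a n n (i, j, false)) : ∃ k : ℕ, k < 2 * n ∧ j = k := by
    rw [inHexagon_up] at hin
    obtain ⟨k, hk⟩ := Int.eq_ofNat_of_zero_le hin.2.2.1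
    exact ⟨k, by omega, hk⟩
  have hocc {i : ℤ} {j : ℕ} (hj : j < 2 * n) (hin : inHexagon a n n (i, j, false))
      (ht : ((i, (j : ℤ), 2) : Tile) ∉ T) : ∃ r, pathsOfTiling a n T j r = i := by
    by_contra! hcon
    exact ht (((pathsFit hT hj).2 _ hin).2 hcon)
  ext ⟨i, j, d⟩
  constructor
  · intro ht
    obtain ⟨j, hj, rfl⟩ := exists_eq_natCast_of_mem_tilesOfPaths ht
    fin_cases d
    · obtain ⟨r, rfl, hs⟩ := (mem_tilesOfPaths_zero hj).1 ht
      rcases (pathsFit hT hj).mem_or_mem hT hj r with ⟨ht', -⟩ | ⟨-, hs'⟩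
      · exact ht'
      · omega
    · obtain ⟨r, rfl, hs⟩ := (mem_tilesOfPaths_one hj).1 ht
      rcases (pathsFit hT hj).mem_or_mem hT hj r with ⟨-, hs'⟩ | ⟨ht', -⟩
      · omega
      · exact ht'
    · obtain ⟨hin, hne⟩ := (mem_tilesOfPaths_two hj).1 ht
      exact ((pathsFit hT hj).2 _ hin).2 hne
  · intro ht
    fin_cases d
    · have hin := (h0 _ _ ht).1
      obtain ⟨j, hj, rfl⟩ := hlevel hin
      obtain ⟨-, -, hu, -⟩ := hup _ _ hin
      obtain ⟨r, rfl⟩ := hocc hj hin fun h => hu ⟨ht, h⟩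
      refine (mem_tilesOfPaths_zero hj).2 ⟨r, rfl, ?_⟩
      rw [pathsOfTiling, if_neg fun h => h.2 ht]
    · have hin := (h1 _ _ ht).1
      obtain ⟨j, hj, rfl⟩ := hlevel hin
      obtain ⟨-, hu', -, hu⟩ := hup _ _ hin
      obtain ⟨r, rfl⟩ := hocc hj hin fun h => hu ⟨ht, h⟩
      refine (mem_tilesOfPaths_one hj).2 ⟨r, rfl, ?_⟩
      rw [pathsOfTiling, if_pos ⟨hj, fun h => hu' ⟨h, ht⟩⟩]
    · have hin := (h2 _ _ ht).1
      obtain ⟨j, hj, rfl⟩ := hlevel hin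
      exact (mem_tilesOfPaths_two hj).2 ⟨hin, ((pathsFit hT hj).2 _ hin).1 ht⟩

end OfTiling

lemma card_tilings_eq_card_pathFamilies (hh : h < 2 * n)
    (hx : inHexagon a n n (x₀, h, false)) :
    Nat.card {T : Set Tile // IsTiling a n n T ∧ ((x₀, (h : ℤ), 2) : Tile) ∈ T} =
      Nat.card (pathFamilies a h x₀ (2 * n) fun r => (r : ℤ) - n) := by
  refine (Nat.card_congr (Equiv.ofBijective (fun y => ⟨tilesOfPaths a n y.1,
    isTiling_tilesOfPaths y.2, (mem_tilesOfPaths_two hh).2 ⟨hx, y.2.2.2.2.2 hh.le⟩⟩)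
    ⟨fun y y' heq => ?_, fun ⟨T, hT, hxT⟩ => ?_⟩)).symm
  · exact Subtype.ext (path_eq_of_tilesOfPaths_eq y.2 y'.2 (congrArg Subtype.val heq))
  · exact ⟨⟨pathsOfTiling a n T, pathsOfTiling_mem hT hh hxT⟩,
      Subtype.ext (tilesOfPaths_pathsOfTiling hT)⟩

end TilingsAsPaths

/-- Theorem 2: for positive integers `m` and `N`, the number of rhombus tilings
of the hexagon with sides `N+1,2m−1,N+1,N+1,2m−1,N+1` (realized here with the
sides of length `2m−1` horizontal, so that the symmetry axis cutting through
them is vertical, passing through the `N` horizontal rhombus positions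
`l = 1,…,N`) which contain the `l`-th rhombus on that symmetry axis, namely the
tile pairing the upward triangle `(m−N+l−2, 2N−2l+2)` with the downward
triangle `(m−N+l−2, 2N−2l+1)`, equals
`m C(m+N,m) C(m+N−1,m)/C(2m+2N−1,2m)
 · ∑_{e=0}^{l−1} (−1)^e C(N,e)(N−2e)(1/2)_e/((m+e)(m+N−e)(1/2−N)_e)
 · ∏_{i=1}^{N+1}∏_{j=1}^{N+1}∏_{k=1}^{2m−1} (i+j+k−1)/(i+j+k−2)`. -/
theorem rhombus_tilings_fixed_rhombus_odd (N : ℕ) (hN : 0 < N) (m : ℕ)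
    (hm : 0 < m) (l : ℕ) (hl : 1 ≤ l) (hlN : l ≤ N) :
    (Nat.card {T : Set Tile // IsTiling (2 * m - 1) (N + 1) (N + 1) T ∧
        ((m : ℤ) - N + l - 2, ((2 * (N : ℤ) - 2 * l + 2 : ℤ), (2 : Fin 3))) ∈ T} : ℚ) =
      ((m : ℚ) * ((m + N).choose m : ℚ) * ((m + N - 1).choose m : ℚ) /
          ((2 * m + 2 * N - 1).choose (2 * m) : ℚ)) *
        (∑ e ∈ Finset.range l,
          (-1 : ℚ) ^ e * (N.choose e : ℚ) * ((N : ℚ) - 2 * e) * poch (1 / 2) e /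
            (((m : ℚ) + e) * ((m : ℚ) + N - e) * poch (1 / 2 - (N : ℚ)) e)) *
        ∏ i ∈ Finset.Icc 1 (N + 1), ∏ j ∈ Finset.Icc 1 (N + 1),
          ∏ k ∈ Finset.Icc 1 (2 * m - 1),
            ((i + j + k - 1 : ℚ) / (i + j + k - 2)) := by
  obtain ⟨p, rfl⟩ : ∃ p, m = p + 1 := ⟨m - 1, by omega⟩
  obtain ⟨M, rfl⟩ : ∃ M, N = M + 1 := ⟨N - 1, by omega⟩
  obtain ⟨s, hs⟩ : ∃ s, M + 1 + 1 = s + l := ⟨M + 2 - l, by omega⟩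
  have ha : 2 * (p + 1) - 1 = 2 * p + 1 := by omega
  have hx : ((p + 1 : ℕ) : ℤ) - (M + 1 : ℕ) + l - 2 = p - s := by omega
  have hy : 2 * ((M + 1 : ℕ) : ℤ) - 2 * l + 2 = (2 * s : ℕ) := by omega
  rw [ha, hx, hy, card_tilings_eq_card_pathFamilies (by omega) (inHexagon_up.2 (by omega)),
    card_pathFamilies (by omega) _ fun i j hij => by simpa using hij]
  have hkernel : (Matrix.of fun i j : Fin (2 * p + 1) =>
      pathKernel (2 * s) (p - s) (2 * (M + 1 + 1)) ((i : ℤ) - (M + 1 + 1 : ℕ)) j) =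
      Matrix.of fun i j : Fin (2 * p + 1) =>
        chooseInt (2 * (M + 1 + 1)) ((M + 1 + 1 : ℕ) + j - i) -
          chooseInt (2 * s) (s + j - p) * chooseInt (2 * l) (l + p - i) := by
    ext i j
    rw [Matrix.of_apply, Matrix.of_apply, pathKernel_eq (by omega), if_pos (by omega),
      show 2 * (M + 1 + 1) - 2 * s = 2 * l by omega]
    congr 2
    · omega
    · exact congrArg _ (by omega)
    · exact congrArg _ (by omega)
  rw [hkernel, det_toeplitz_sub (by omega) hs, one_sub_sum_holeTerm p (by omega) hs,
    det_toeplitz_eq_prod_box, prefactor_eq, axisPrefactor]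
  congr 2
  · push_cast
    ring_nf
  · refine Finset.sum_congr rfl fun e he => ?_
    rw [axisWeight, Nat.add_sub_cancel]
    push_cast
    rw [div_mul_eq_mul_div, div_div]
    congr 1 <;> ring
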